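/- Let m ≥ 3 and suppose the dihedral-type Artin group A(m), with Artin generators a and b, acts properly discontinuously by semi-simple isometries on a CAT(0) metric space X of covering dimension ≤ 2. Let Δ = (a,b)_m and let z = Δ² if m is odd, z = Δ if m is even (so z is central in A(m)). Then the set B(a,b) = Min(a) ∩ Min(z) ∩ Min(b) is nonempty, and there exist w > 0 and an isometric embedding j : [0,w] × ℝ → X (with the Euclidean product metric) whose image is exactly B(a,b), such that each line j({s} × ℝ), s ∈ [0,w], is an axis of z (a z-invariant geodesic line along which z translates by ℓ(z)). -/

import Mathlib

/-! Common definitions: geodesic spaces, CAT(0) spaces, covering dimension,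
translation length, semi-simple isometries, properly discontinuous actions,
ℝ-trees, axes, flat strips, and Artin group presentations. -/

/-- The alternating product `x y x y ⋯` of length `k`. -/
def altProd {G : Type*} [Monoid G] (x y : G) : ℕ → G
  | 0 => 1
  | Nat.succ k => x * altProd y x k

/-- `γ` is a geodesic from `x` to `y`, i.e. an isometric map of `[0, dist x y]`
into the space with endpoints `x` and `y`. -/
def IsGeodesic {X : Type*} [MetricSpace X] (x y : X) (γ : ℝ → X) : Prop :=
  γ 0 = x ∧ γ (dist x y) = y ∧
    ∀ s ∈ Set.Icc (0:ℝ) (dist x y), ∀ t ∈ Set.Icc (0:ℝ) (dist x y),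
      dist (γ s) (γ t) = |s - t|

/-- A metric space is geodesic if any two points are joined by a geodesic. -/
def IsGeodesicSpace (X : Type*) [MetricSpace X] : Prop :=
  ∀ x y : X, ∃ γ : ℝ → X, IsGeodesic x y γ

/-- The comparison point at arclength parameter `s` on the Euclidean segment from `x'`
to `y'`, where `d` is the length of the corresponding side of the original triangle. -/
noncomputable def cmpPoint (d : ℝ) (x' y' : EuclideanSpace ℝ (Fin 2)) (s : ℝ) :
    EuclideanSpace ℝ (Fin 2) :=
  x' + (s / d) • (y' - x')

/-- A CAT(0) space: a geodesic metric space in which every geodesic triangle satisfies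
the comparison inequality with respect to a comparison triangle in the Euclidean plane. -/
def IsCAT0 (X : Type*) [MetricSpace X] : Prop :=
  IsGeodesicSpace X ∧
  ∀ (x y z : X) (γ₁ γ₂ : ℝ → X), IsGeodesic x y γ₁ → IsGeodesic x z γ₂ →
    ∀ x' y' z' : EuclideanSpace ℝ (Fin 2),
      dist x' y' = dist x y → dist x' z' = dist x z → dist y' z' = dist y z →
      ∀ s ∈ Set.Icc (0:ℝ) (dist x y), ∀ t ∈ Set.Icc (0:ℝ) (dist x z),
        dist (γ₁ s) (γ₂ t) ≤
          dist (cmpPoint (dist x y) x' y' s) (cmpPoint (dist x z) x' z' t)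

/-- Covering dimension at most `n`: every open cover admits an open refinement in which
every point lies in at most `n + 1` members. -/
def CovDimLE (X : Type*) [TopologicalSpace X] (n : ℕ) : Prop :=
  ∀ U : Set (Set X), (∀ u ∈ U, IsOpen u) → ⋃₀ U = Set.univ →
    ∃ V : Set (Set X), (∀ v ∈ V, IsOpen v) ∧ ⋃₀ V = Set.univ ∧
      (∀ v ∈ V, ∃ u ∈ U, v ⊆ u) ∧
      ∀ x : X, ∃ F : Finset (Set X), F.card ≤ n + 1 ∧ {v | v ∈ V ∧ x ∈ v} ⊆ ↑F

/-- The translation length of a self-map of a metric space. -/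
noncomputable def transLen {X : Type*} [MetricSpace X] (f : X → X) : ℝ :=
  sInf (Set.range fun x => dist x (f x))

/-- A self-map is semi-simple if its translation length is attained. -/
def SemiSimple {X : Type*} [MetricSpace X] (f : X → X) : Prop :=
  ∃ x, dist x (f x) = transLen f

/-- The minset of a self-map of a metric space. -/
def MinSet {X : Type*} [MetricSpace X] (f : X → X) : Set X :=
  {x | dist x (f x) = transLen f}

/-- An action by isometries (given by a homomorphism to the isometry group) is properly
discontinuous if each compact set meets only finitely many of its translates. -/
def ProperlyDisc {G X : Type*} [Group G] [MetricSpace X] (φ : G →* (X ≃ᵢ X)) : Prop :=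
  ∀ K : Set X, IsCompact K → Set.Finite {g : G | ((φ g) '' K ∩ K).Nonempty}

/-- An ℝ-tree: a geodesic metric space satisfying the four-point condition. -/
def IsRTree (T : Type*) [MetricSpace T] : Prop :=
  IsGeodesicSpace T ∧
  ∀ x y z w : T,
    dist x y + dist z w ≤ max (dist x z + dist y w) (dist x w + dist y z)

/-- `L` is an axis of `f`: an `f`-invariant geodesic line along which `f` translates
by its translation length. -/
def IsAxisOf {X : Type*} [MetricSpace X] (f : X → X) (L : Set X) : Prop :=
  ∃ c : ℝ → X, (∀ s t : ℝ, dist (c s) (c t) = |s - t|) ∧ Set.range c = L ∧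
    ∀ t : ℝ, f (c t) = c (t + transLen f)

/-- `j` is an isometric embedding of the Euclidean strip `[0,w] × ℝ` into `X`. -/
def FlatStrip {X : Type*} [MetricSpace X] (w : ℝ) (j : Set.Icc (0:ℝ) w × ℝ → X) : Prop :=
  ∀ p q : Set.Icc (0:ℝ) w × ℝ,
    dist (j p) (j q) = Real.sqrt (((p.1 : ℝ) - (q.1 : ℝ))^2 + (p.2 - q.2)^2)

/-- The set `S` is a flat strip of some positive width `w`, each of whose vertical lines
is an axis of `f`. -/
def StripWithAxes {X : Type*} [MetricSpace X] (f : X → X) (S : Set X) : Prop :=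
  ∃ w : ℝ, 0 < w ∧ ∃ j : Set.Icc (0:ℝ) w × ℝ → X,
    FlatStrip w j ∧ Set.range j = S ∧
    ∀ s : Set.Icc (0:ℝ) w, IsAxisOf f (Set.range fun t : ℝ => j (s, t))

/-- The relations of the Artin group `A(m,n,2)` on generators `a = 0`, `b = 1`, `c = 2`:
`(a,b)_m = (b,a)_m`, `(b,c)_n = (c,b)_n` and `ac = ca`. -/
def artinRel3 (m n : ℕ) : Set (FreeGroup (Fin 3)) :=
  { altProd (FreeGroup.of 0) (FreeGroup.of 1) m *
      (altProd (FreeGroup.of 1) (FreeGroup.of 0) m)⁻¹,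
    altProd (FreeGroup.of 1) (FreeGroup.of 2) n *
      (altProd (FreeGroup.of 2) (FreeGroup.of 1) n)⁻¹,
    FreeGroup.of 0 * FreeGroup.of 2 * (FreeGroup.of 0)⁻¹ * (FreeGroup.of 2)⁻¹ }

/-- The relation of the dihedral-type Artin group `A(m)` on generators `a = 0`, `b = 1`:
`(a,b)_m = (b,a)_m`. -/
def dihedralRel (m : ℕ) : Set (FreeGroup (Fin 2)) :=
  { altProd (FreeGroup.of 0) (FreeGroup.of 1) m *
      (altProd (FreeGroup.of 1) (FreeGroup.of 0) m)⁻¹ }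

/-! ### A discrete Stokes formula and the Poincaré–Miranda theorem -/

/-- The cup product `δg ∪ δh` on the square with lowest vertex `(j, k)`. -/
def cupTwo (g h : ℕ → ℕ → ℤ) (j k : ℕ) : ℤ :=
  (g (j + 1) k - g j k) * (h (j + 1) (k + 1) - h (j + 1) k) -
    (g j (k + 1) - g j k) * (h (j + 1) (k + 1) - h j (k + 1))

/-- The cup product `δf ∪ δg ∪ δh` on the cube with lowest vertex `(i, j, k)`. -/
def cupThree (f g h : ℕ → ℕ → ℕ → ℤ) (i j k : ℕ) : ℤ :=
  (f (i + 1) j k - f i j k) * cupTwo (g (i + 1)) (h (i + 1)) j k -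
  (f i (j + 1) k - f i j k) *
    cupTwo (fun a c => g a (j + 1) c) (fun a c => h a (j + 1) c) i k +
  (f i j (k + 1) - f i j k) *
    cupTwo (fun a b => g a b (k + 1)) (fun a b => h a b (k + 1)) i j

theorem sum_cupTwo (g h : ℕ → ℕ → ℤ) (N : ℕ)
    (g0 : ∀ k ≤ N, g 0 k = 0) (g1 : ∀ k ≤ N, g N k = 1)
    (h0 : ∀ j ≤ N, h j 0 = 0) (h1 : ∀ j ≤ N, h j N = 1) :
    ∑ j ∈ Finset.range N, ∑ k ∈ Finset.range N, cupTwo g h j k = 1 := by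
  have key : ∀ j k, cupTwo g h j k =
      (g (j + 1) k * (h (j + 1) (k + 1) - h (j + 1) k) - g j k * (h j (k + 1) - h j k)) -
      (g j (k + 1) * (h (j + 1) (k + 1) - h j (k + 1)) - g j k * (h (j + 1) k - h j k)) := by
    intro j k; unfold cupTwo; ring
  simp only [key, Finset.sum_sub_distrib]
  have e1 : ∑ j ∈ Finset.range N, ∑ k ∈ Finset.range N,
        g (j + 1) k * (h (j + 1) (k + 1) - h (j + 1) k) -
      ∑ j ∈ Finset.range N, ∑ k ∈ Finset.range N, g j k * (h j (k + 1) - h j k) = 1 := by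
    rw [← Finset.sum_sub_distrib,
      Finset.sum_range_sub (fun j => ∑ k ∈ Finset.range N, g j k * (h j (k + 1) - h j k))]
    have a1 : ∑ k ∈ Finset.range N, g N k * (h N (k + 1) - h N k) = 1 := by
      have : ∑ k ∈ Finset.range N, g N k * (h N (k + 1) - h N k) =
          ∑ k ∈ Finset.range N, (h N (k + 1) - h N k) :=
        Finset.sum_congr rfl fun k hk => by
          rw [g1 k (Finset.mem_range.1 hk).le, one_mul]
      rw [this, Finset.sum_range_sub, h1 N le_rfl, h0 N le_rfl, sub_zero]
    have a2 : ∑ k ∈ Finset.range N, g 0 k * (h 0 (k + 1) - h 0 k) = 0 :=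
      Finset.sum_eq_zero fun k hk => by rw [g0 k (Finset.mem_range.1 hk).le, zero_mul]
    rw [a1, a2, sub_zero]
  have e2 : ∑ j ∈ Finset.range N, ∑ k ∈ Finset.range N,
        g j (k + 1) * (h (j + 1) (k + 1) - h j (k + 1)) -
      ∑ j ∈ Finset.range N, ∑ k ∈ Finset.range N, g j k * (h (j + 1) k - h j k) = 0 := by
    rw [← Finset.sum_sub_distrib]
    refine Finset.sum_eq_zero fun j hj => ?_
    have hj' := Finset.mem_range.1 hj
    rw [← Finset.sum_sub_distrib,
      Finset.sum_range_sub (fun k => g j k * (h (j + 1) k - h j k)),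
      h1 _ hj', h1 _ hj'.le, h0 _ hj', h0 _ hj'.le]
    ring
  rw [e1, e2, sub_zero]

theorem sum_cupThree (f g h : ℕ → ℕ → ℕ → ℤ) (N : ℕ)
    (f0 : ∀ j ≤ N, ∀ k ≤ N, f 0 j k = 0) (f1 : ∀ j ≤ N, ∀ k ≤ N, f N j k = 1)
    (g0 : ∀ i ≤ N, ∀ k ≤ N, g i 0 k = 0) (g1 : ∀ i ≤ N, ∀ k ≤ N, g i N k = 1)
    (h0 : ∀ i ≤ N, ∀ j ≤ N, h i j 0 = 0) (h1 : ∀ i ≤ N, ∀ j ≤ N, h i j N = 1) :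
    ∑ i ∈ Finset.range N, ∑ j ∈ Finset.range N, ∑ k ∈ Finset.range N,
      cupThree f g h i j k = 1 := by
  have key : ∀ i j k, cupThree f g h i j k =
      (f (i + 1) j k * cupTwo (g (i + 1)) (h (i + 1)) j k - f i j k * cupTwo (g i) (h i) j k) -
      (f i (j + 1) k * cupTwo (fun a c => g a (j + 1) c) (fun a c => h a (j + 1) c) i k -
        f i j k * cupTwo (fun a c => g a j c) (fun a c => h a j c) i k) +
      (f i j (k + 1) * cupTwo (fun a b => g a b (k + 1)) (fun a b => h a b (k + 1)) i j -
        f i j k * cupTwo (fun a b => g a b k) (fun a b => h a b k) i j) := by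
    intro i j k; unfold cupThree cupTwo; ring
  simp only [key, Finset.sum_sub_distrib, Finset.sum_add_distrib]
  have e1 : ∑ i ∈ Finset.range N, ∑ j ∈ Finset.range N, ∑ k ∈ Finset.range N,
        f (i + 1) j k * cupTwo (g (i + 1)) (h (i + 1)) j k -
      ∑ i ∈ Finset.range N, ∑ j ∈ Finset.range N, ∑ k ∈ Finset.range N,
        f i j k * cupTwo (g i) (h i) j k = 1 := by
    rw [← Finset.sum_sub_distrib, Finset.sum_range_sub (fun i => ∑ j ∈ Finset.range N,
      ∑ k ∈ Finset.range N, f i j k * cupTwo (g i) (h i) j k)]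
    have a1 : ∑ j ∈ Finset.range N, ∑ k ∈ Finset.range N,
        f N j k * cupTwo (g N) (h N) j k = 1 := by
      rw [← sum_cupTwo (g N) (h N) N (g0 N le_rfl) (g1 N le_rfl) (h0 N le_rfl) (h1 N le_rfl)]
      refine Finset.sum_congr rfl fun j hj => Finset.sum_congr rfl fun k hk => ?_
      rw [f1 j (Finset.mem_range.1 hj).le k (Finset.mem_range.1 hk).le, one_mul]
    have a2 : ∑ j ∈ Finset.range N, ∑ k ∈ Finset.range N,
        f 0 j k * cupTwo (g 0) (h 0) j k = 0 :=
      Finset.sum_eq_zero fun j hj => Finset.sum_eq_zero fun k hk => by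
        rw [f0 j (Finset.mem_range.1 hj).le k (Finset.mem_range.1 hk).le, zero_mul]
    rw [a1, a2, sub_zero]
  have e2 : ∑ i ∈ Finset.range N, ∑ j ∈ Finset.range N, ∑ k ∈ Finset.range N,
        f i (j + 1) k * cupTwo (fun a c => g a (j + 1) c) (fun a c => h a (j + 1) c) i k -
      ∑ i ∈ Finset.range N, ∑ j ∈ Finset.range N, ∑ k ∈ Finset.range N,
        f i j k * cupTwo (fun a c => g a j c) (fun a c => h a j c) i k = 0 := by
    rw [← Finset.sum_sub_distrib]
    refine Finset.sum_eq_zero fun i hi => ?_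
    have hi' := Finset.mem_range.1 hi
    rw [← Finset.sum_sub_distrib, Finset.sum_range_sub (fun j => ∑ k ∈ Finset.range N,
      f i j k * cupTwo (fun a c => g a j c) (fun a c => h a j c) i k),
      ← Finset.sum_sub_distrib]
    refine Finset.sum_eq_zero fun k hk => ?_
    have hk' := Finset.mem_range.1 hk
    simp only [cupTwo]
    rw [g0 _ hi' _ hk'.le, g0 _ hi'.le _ hk'.le, g0 _ hi'.le _ hk', g1 _ hi' _ hk'.le,
      g1 _ hi'.le _ hk'.le, g1 _ hi'.le _ hk']
    ring
  have e3 : ∑ i ∈ Finset.range N, ∑ j ∈ Finset.range N, ∑ k ∈ Finset.range N,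
        f i j (k + 1) * cupTwo (fun a b => g a b (k + 1)) (fun a b => h a b (k + 1)) i j -
      ∑ i ∈ Finset.range N, ∑ j ∈ Finset.range N, ∑ k ∈ Finset.range N,
        f i j k * cupTwo (fun a b => g a b k) (fun a b => h a b k) i j = 0 := by
    rw [← Finset.sum_sub_distrib]
    refine Finset.sum_eq_zero fun i hi => ?_
    have hi' := Finset.mem_range.1 hi
    rw [← Finset.sum_sub_distrib]
    refine Finset.sum_eq_zero fun j hj => ?_
    have hj' := Finset.mem_range.1 hj
    rw [← Finset.sum_sub_distrib, Finset.sum_range_sub (fun k =>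
      f i j k * cupTwo (fun a b => g a b k) (fun a b => h a b k) i j)]
    simp only [cupTwo]
    rw [h0 _ hi' _ hj', h0 _ hi' _ hj'.le, h0 _ hi'.le _ hj', h1 _ hi' _ hj',
      h1 _ hi' _ hj'.le, h1 _ hi'.le _ hj']
    ring
  rw [e1, e2, e3]
  ring

/-- A three-dimensional version of Steinhaus' chessboard theorem. -/
theorem exists_cube_nonconstant (f : Fin 3 → (Fin 3 → ℕ) → ℤ) (N : ℕ)
    (f0 : ∀ i v, v ≤ (fun _ => N) → v i = 0 → f i v = 0)
    (f1 : ∀ i v, v ≤ (fun _ => N) → v i = N → f i v = 1) :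
    ∃ v : Fin 3 → ℕ, (∀ i, v i < N) ∧
      ∀ i, ∃ w, v ≤ w ∧ w ≤ v + 1 ∧ f i w ≠ f i v := by
  have hs := sum_cupThree (fun a b c => f 0 ![a, b, c]) (fun a b c => f 1 ![a, b, c])
    (fun a b c => f 2 ![a, b, c]) N
    (fun j hj k hk => f0 0 _ (by intro i; fin_cases i <;> simp [hj, hk]) (by simp))
    (fun j hj k hk => f1 0 _ (by intro i; fin_cases i <;> simp [hj, hk]) (by simp))
    (fun j hj k hk => f0 1 _ (by intro i; fin_cases i <;> simp [hj, hk]) (by simp))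
    (fun j hj k hk => f1 1 _ (by intro i; fin_cases i <;> simp [hj, hk]) (by simp))
    (fun j hj k hk => f0 2 _ (by intro i; fin_cases i <;> simp [hj, hk]) (by simp))
    (fun j hj k hk => f1 2 _ (by intro i; fin_cases i <;> simp [hj, hk]) (by simp))
  obtain ⟨i, hi, h⟩ := Finset.exists_ne_zero_of_sum_ne_zero (hs.trans_ne one_ne_zero)
  obtain ⟨j, hj, h⟩ := Finset.exists_ne_zero_of_sum_ne_zero h
  obtain ⟨k, hk, h⟩ := Finset.exists_ne_zero_of_sum_ne_zero h
  rw [Finset.mem_range] at hi hj hk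
  refine ⟨![i, j, k], fun l => by fin_cases l <;> simp [hi, hj, hk], fun l => ?_⟩
  by_contra! hc
  have hc' : ∀ a b c, i ≤ a → a ≤ i + 1 → j ≤ b → b ≤ j + 1 → k ≤ c → c ≤ k + 1 →
      f l ![a, b, c] = f l ![i, j, k] := by
    intro a b c h1 h2 h3 h4 h5 h6
    exact hc _ (by intro i; fin_cases i <;> simp [*]) (by intro i; fin_cases i <;> simp [*])
  have c1 := hc' (i + 1) j k (by simp) (by simp) (by simp) (by simp) (by simp) (by simp)
  have c2 := hc' i (j + 1) k (by simp) (by simp) (by simp) (by simp) (by simp) (by simp)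
  have c3 := hc' i j (k + 1) (by simp) (by simp) (by simp) (by simp) (by simp) (by simp)
  have c4 := hc' (i + 1) (j + 1) k (by simp) (by simp) (by simp) (by simp) (by simp) (by simp)
  have c5 := hc' (i + 1) j (k + 1) (by simp) (by simp) (by simp) (by simp) (by simp) (by simp)
  have c6 := hc' i (j + 1) (k + 1) (by simp) (by simp) (by simp) (by simp) (by simp) (by simp)
  have c7 := hc' (i + 1) (j + 1) (k + 1) (by simp) (by simp) (by simp) (by simp) (by simp)
    (by simp)
  apply h
  fin_cases l <;> simp only [Fin.zero_eta, Fin.mk_one, Fin.reduceFinMk] at c1 c2 c3 c4 c5 c6 c7 <;>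
    simp only [cupThree, cupTwo, c1, c2, c3, c4, c5, c6, c7] <;> ring

/-- The Poincaré–Miranda theorem on the three-dimensional unit cube. -/
theorem poincare_miranda_three (G : Fin 3 → (Fin 3 → ℝ) → ℝ) (hG : ∀ i, Continuous (G i))
    (h0 : ∀ i, ∀ x ∈ Set.Icc (0 : Fin 3 → ℝ) 1, x i = 0 → G i x < 0)
    (h1 : ∀ i, ∀ x ∈ Set.Icc (0 : Fin 3 → ℝ) 1, x i = 1 → 0 < G i x) :
    ∃ x ∈ Set.Icc (0 : Fin 3 → ℝ) 1, ∀ i, G i x = 0 := by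
  by_contra! hne
  have hGc : Continuous fun x : Fin 3 → ℝ => fun i => G i x := continuous_pi hG
  obtain ⟨x₀, hx₀, hmin⟩ := isCompact_Icc.exists_isMinOn
    (⟨0, by simp⟩ : (Set.Icc (0 : Fin 3 → ℝ) 1).Nonempty) (hGc.norm.continuousOn)
  have hε : 0 < ‖fun i => G i x₀‖ := by
    rw [norm_pos_iff]
    obtain ⟨i, hi⟩ := hne x₀ hx₀
    exact fun h => hi (congrFun h i)
  set ε := ‖fun i => G i x₀‖ with hεdef
  have hu := (isCompact_Icc (a := (0 : Fin 3 → ℝ)) (b := 1)).uniformContinuousOn_of_continuous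
    hGc.continuousOn
  rw [Metric.uniformContinuousOn_iff] at hu
  obtain ⟨δ, hδ, hu⟩ := hu ε hε
  obtain ⟨n, hn⟩ := exists_nat_one_div_lt hδ
  set N := n + 1 with hN
  have hNpos : (0 : ℝ) < N := by rw [hN]; positivity
  let P : (Fin 3 → ℕ) → Fin 3 → ℝ := fun v i => (v i : ℝ) / N
  have hP : ∀ v : Fin 3 → ℕ, v ≤ (fun _ => N) → P v ∈ Set.Icc (0 : Fin 3 → ℝ) 1 := by
    intro v hv
    refine ⟨fun i => by simp only [P, Pi.zero_apply]; positivity, fun i => ?_⟩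
    have := hv i
    simp only [P, Pi.one_apply]
    rw [div_le_one hNpos]
    exact_mod_cast this
  obtain ⟨v, hv, hvc⟩ := exists_cube_nonconstant
    (fun i v => if 0 < G i (P v) then 1 else 0) N
    (fun i v hv hi => if_neg (not_lt.2 (h0 i _ (hP v hv) (by simp [P, hi])).le))
    (fun i v hv hi => if_pos (h1 i _ (hP v hv) (by simp [P, hi, hNpos.ne'])))
  have hvP := hP v fun i => (hv i).le
  obtain ⟨i, hi⟩ : ∃ i, ε ≤ |G i (P v)| := by
    by_contra! hlt
    have h2 : ‖fun i => G i (P v)‖ < ε := (pi_norm_lt_iff hε).2 hlt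
    exact absurd (hmin hvP) (not_le.2 h2)
  obtain ⟨w, hvw, hwv, hw⟩ := hvc i
  have hwP := hP w fun i => (hwv i).trans (hv i)
  have hd : dist (P w) (P v) < δ := by
    refine lt_of_le_of_lt ((dist_pi_le_iff (by positivity)).2 fun k => ?_) hn
    have h1 : (v k : ℝ) ≤ w k := by exact_mod_cast hvw k
    have h2 : (w k : ℝ) ≤ v k + 1 := by exact_mod_cast hwv k
    rw [Real.dist_eq]
    simp only [P]
    rw [← sub_div, abs_of_nonneg (div_nonneg (by linarith) hNpos.le), hN]
    push_cast
    gcongr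
    linarith
  have h3 := hu _ hwP _ hvP hd
  have h4 : |G i (P w) - G i (P v)| < ε := by
    have := (dist_pi_lt_iff hε).1 h3 i
    rwa [Real.dist_eq] at this
  apply hw
  rcases le_abs.1 hi with h5 | h5
  · rw [if_pos (by linarith [abs_lt.1 h4]), if_pos (by linarith)]
  · rw [if_neg (by linarith [abs_lt.1 h4]), if_neg (by linarith)]

/-! ### Covering dimension and maps of the cube -/

theorem false_of_three_weights (α β γ : ℝ) (x y z : Fin 3 → ℝ) (hS : 0 < α + β + γ)
    (hx : ∀ i, x i = 0 ∨ x i = 1) (hy : ∀ i, y i = 0 ∨ y i = 1) (hz : ∀ i, z i = 0 ∨ z i = 1)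
    (h : ∀ i, α * x i + β * y i + γ * z i =
      (![1 / 10, 1 / 5, 2 / 5] : Fin 3 → ℝ) i * (α + β + γ)) : False := by
  have key : ∀ i, ∀ q : ℝ, 0 < q → q < 1 →
      α * x i + β * y i + γ * z i = q * (α + β + γ) →
      q * (α + β + γ) = α ∨ q * (α + β + γ) = β ∨ q * (α + β + γ) = γ ∨
      q * (α + β + γ) = α + β ∨ q * (α + β + γ) = α + γ ∨ q * (α + β + γ) = β + γ := by
    intro i q hq0 hq1 hi
    have p0 : 0 < q * (α + β + γ) := mul_pos hq0 hS
    have p1 : q * (α + β + γ) < α + β + γ := by nlinarith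
    rw [← hi] at p0 p1 ⊢
    rcases hx i with h1 | h1 <;> rcases hy i with h2 | h2 <;> rcases hz i with h3 | h3 <;>
      simp only [h1, h2, h3, mul_zero, mul_one, zero_add, add_zero] at p0 p1 ⊢ <;> simp at p0 p1 ⊢
  have h0 := key 0 (1 / 10) (by norm_num) (by norm_num) (by simpa using h 0)
  have h1 := key 1 (1 / 5) (by norm_num) (by norm_num) (by simpa using h 1)
  have h2 := key 2 (2 / 5) (by norm_num) (by norm_num) (by simpa using h 2)
  clear key h hx hy hz
  rcases h0 with h0 | h0 | h0 | h0 | h0 | h0 <;> rcases h1 with h1 | h1 | h1 | h1 | h1 | h1 <;>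
    first
    | linarith
    | (rcases h2 with h2 | h2 | h2 | h2 | h2 | h2 <;> linarith)

theorem false_of_weights {ι : Type*} (s : Finset ι) (hs : s.card ≤ 3) (w : ι → ℝ)
    (c : ι → Fin 3 → ℝ) (hc : ∀ v i, c v i = 0 ∨ c v i = 1) (hw : 0 < ∑ v ∈ s, w v)
    (h : ∀ i, ∑ v ∈ s, w v * c v i =
      (![1 / 10, 1 / 5, 2 / 5] : Fin 3 → ℝ) i * ∑ v ∈ s, w v) : False := by
  classical
  obtain h0 | h0 | h0 | h0 : s.card = 0 ∨ s.card = 1 ∨ s.card = 2 ∨ s.card = 3 := by omega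
  · rw [Finset.card_eq_zero.1 h0] at hw; simp at hw
  · obtain ⟨a, rfl⟩ := Finset.card_eq_one.1 h0
    exact false_of_three_weights (w a) 0 0 (c a) 0 0 (by simpa using hw) (hc a) (by simp)
      (by simp) fun i => by simpa using h i
  · obtain ⟨a, b, hab, rfl⟩ := Finset.card_eq_two.1 h0
    exact false_of_three_weights (w a) (w b) 0 (c a) (c b) 0
      (by simpa [Finset.sum_pair hab] using hw) (hc a) (hc b) (by simp)
      fun i => by simpa [Finset.sum_pair hab] using h i
  · obtain ⟨a, b, d, hab, had, hbd, rfl⟩ := Finset.card_eq_three.1 h0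
    have hsum : ∀ f : ι → ℝ, ∑ v ∈ {a, b, d}, f v = f a + f b + f d := fun f => by
      rw [Finset.sum_insert (by simp [hab, had]), Finset.sum_pair hbd, add_assoc]
    simp only [hsum] at h hw
    exact false_of_three_weights (w a) (w b) (w d) (c a) (c b) (c d) hw (hc a) (hc b) (hc d) h

/-- A continuous map from the three-dimensional cube to a space of covering dimension at most
two cannot keep all three pairs of opposite faces disjoint. -/
theorem CovDimLE.exists_opposite_faces_meet {X : Type*} [MetricSpace X] (h : CovDimLE X 2)
    (Γ : (Fin 3 → ℝ) → X) (hΓ : Continuous Γ) :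
    ∃ i, ∃ x ∈ Set.Icc (0 : Fin 3 → ℝ) 1, ∃ y ∈ Set.Icc (0 : Fin 3 → ℝ) 1,
      x i = 0 ∧ y i = 1 ∧ Γ x = Γ y := by
  classical
  by_contra! hne
  let F : Fin 3 → ℝ → Set X := fun i r => Γ '' {x ∈ Set.Icc (0 : Fin 3 → ℝ) 1 | x i = r}
  have hF : ∀ i r, IsClosed (F i r) := fun i r =>
    ((isCompact_Icc.inter_right (isClosed_eq (continuous_apply i) continuous_const)).image
      hΓ).isClosed
  have hdisj : ∀ i x, x ∈ F i 0 → x ∉ F i 1 := by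
    rintro i _ ⟨x, ⟨hx, hx0⟩, rfl⟩ ⟨y, ⟨hy, hy1⟩, hxy⟩
    exact hne i x hx y hy hx0 hy1 hxy.symm
  let W : (Fin 3 → Bool) → Set X := fun ε => ⋂ i, (F i (if ε i then 1 else 0))ᶜ
  obtain ⟨V, hVo, hVc, hVr, hVn⟩ := h (Set.range W)
    (by
      rintro _ ⟨ε, rfl⟩
      exact isOpen_iInter_of_finite fun i => (hF i _).isOpen_compl)
    (by
      refine Set.eq_univ_of_forall fun x => ?_
      refine ⟨_, ⟨fun i => decide (x ∉ F i 1), rfl⟩, Set.mem_iInter.2 fun i => ?_⟩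
      by_cases hx : x ∈ F i 1
      · simpa [hx] using fun h0 => hdisj i x h0 hx
      · simp [hx])
  have hface : ∀ v ∈ V, ∀ i, (v ∩ F i 0).Nonempty → ¬ (v ∩ F i 1).Nonempty := by
    rintro v hv i ⟨x, hxv, hx⟩ ⟨y, hyv, hy⟩
    obtain ⟨_, ⟨ε, rfl⟩, hvε⟩ := hVr v hv
    have h1 := Set.mem_iInter.1 (hvε hxv) i
    have h2 := Set.mem_iInter.1 (hvε hyv) i
    cases hε : ε i <;> simp [hε] at h1 h2
    · exact h1 hx
    · exact h2 hy
  have hvne : ∀ v ∈ V, (vᶜ).Nonempty := by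
    intro v hv
    by_contra hcon
    rw [Set.not_nonempty_iff_eq_empty, Set.compl_empty_iff] at hcon
    refine hface v hv 0 ⟨Γ 0, by simp [hcon], 0, by simp, rfl⟩ ⟨Γ 1, by simp [hcon], 1, by simp, rfl⟩
  obtain ⟨t, ht⟩ := (isCompact_Icc (a := (0 : Fin 3 → ℝ)) (b := 1)).elim_finite_subcover
    (fun v : V => Γ ⁻¹' v) (fun v => (hVo v v.2).preimage hΓ) (by
      intro x _
      obtain ⟨v, hv, hxv⟩ := hVc.ge (Set.mem_univ (Γ x))
      exact Set.mem_iUnion.2 ⟨⟨v, hv⟩, hxv⟩)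
  let d : V → (Fin 3 → ℝ) → ℝ := fun v x => Metric.infDist (Γ x) (v : Set X)ᶜ
  have hd0 : ∀ v x, 0 ≤ d v x := fun v x => Metric.infDist_nonneg
  have hdp : ∀ v : V, ∀ x, 0 < d v x ↔ Γ x ∈ (v : Set X) := by
    intro v x
    have := ((hVo v v.2).isClosed_compl).notMem_iff_infDist_pos (hvne v v.2) (x := Γ x)
    simpa using this.symm
  have hS : ∀ x ∈ Set.Icc (0 : Fin 3 → ℝ) 1, 0 < ∑ v ∈ t, d v x := by
    intro x hx
    obtain ⟨v, hv, hxv⟩ := Set.mem_iUnion₂.1 (ht hx)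
    exact Finset.sum_pos' (fun v _ => hd0 v x) ⟨v, hv, (hdp v x).2 hxv⟩
  let c : V → Fin 3 → ℝ := fun v i => if ((v : Set X) ∩ F i 1).Nonempty then 1 else 0
  let q : Fin 3 → ℝ := ![1 / 10, 1 / 5, 2 / 5]
  have hq : ∀ i, 0 < q i ∧ q i < 1 := by intro i; fin_cases i <;> norm_num [q]
  obtain ⟨x, hx, hx0⟩ := poincare_miranda_three (fun i x => ∑ v ∈ t, d v x * (c v i - q i))
    (fun i => continuous_finsetSum _ fun v _ =>
      ((Metric.continuous_infDist_pt _).comp hΓ).mul continuous_const)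
    (by
      intro i x hx hxi
      have : ∑ v ∈ t, d v x * (c v i - q i) = - q i * ∑ v ∈ t, d v x := by
        rw [Finset.mul_sum]
        refine Finset.sum_congr rfl fun v _ => ?_
        rcases (hd0 v x).eq_or_lt with h0 | h0
        · rw [← h0]; ring
        · have hc : c v i = 0 := if_neg (hface v v.2 i ⟨Γ x, (hdp v x).1 h0, x, ⟨hx, hxi⟩, rfl⟩)
          rw [hc]; ring
      simp only [this]
      nlinarith [hS x hx, hq i])
    (by
      intro i x hx hxi
      have : ∑ v ∈ t, d v x * (c v i - q i) = (1 - q i) * ∑ v ∈ t, d v x := by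
        rw [Finset.mul_sum]
        refine Finset.sum_congr rfl fun v _ => ?_
        rcases (hd0 v x).eq_or_lt with h0 | h0
        · rw [← h0]; ring
        · have hc : c v i = 1 := if_pos ⟨Γ x, (hdp v x).1 h0, x, ⟨hx, hxi⟩, rfl⟩
          rw [hc]; ring
      simp only [this]
      nlinarith [hS x hx, hq i])
  obtain ⟨E, hE, hEs⟩ := hVn (Γ x)
  let s : Finset V := {v ∈ t | Γ x ∈ (v : Set X)}
  have hs : s.card ≤ 3 := by
    refine le_trans ?_ hE
    refine Finset.card_le_card_of_injOn (fun v => (v : Set X)) ?_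
      (Subtype.val_injective.injOn)
    intro v hv
    exact hEs ⟨v.2, (Finset.mem_filter.1 hv).2⟩
  have hsum : ∀ f : V → ℝ, ∑ v ∈ t, d v x * f v = ∑ v ∈ s, d v x * f v := by
    intro f
    refine (Finset.sum_subset (Finset.filter_subset _ _) fun v hv hvs => ?_).symm
    have : ¬ 0 < d v x := fun h => hvs (Finset.mem_filter.2 ⟨hv, (hdp v x).1 h⟩)
    rw [le_antisymm (not_lt.1 this) (hd0 v x), zero_mul]
  have hS' := hsum fun _ => 1
  simp only [mul_one] at hS'
  refine false_of_weights s hs (fun v => d v x) c (fun v i => ?_) (hS' ▸ hS x hx) fun i => ?_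
  · by_cases hvi : ((v : Set X) ∩ F i 1).Nonempty
    · exact Or.inr (if_pos hvi)
    · exact Or.inl (if_neg hvi)
  · have h1 := hx0 i
    simp only [hsum, mul_sub, Finset.sum_sub_distrib, ← Finset.sum_mul] at h1
    simp only [q] at h1
    linarith

/-! ### Basic CAT(0) geometry -/

theorem exists_comparison_triangle {X : Type*} [MetricSpace X] (x y z : X) :
    ∃ x' y' z' : EuclideanSpace ℝ (Fin 2),
      dist x' y' = dist x y ∧ dist x' z' = dist x z ∧ dist y' z' = dist y z := by
  have h1 := dist_triangle x y z
  have h2 := dist_triangle y x z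
  have h3 := dist_triangle x z y
  rw [dist_comm y x] at h2
  rw [dist_comm z y] at h3
  rcases (dist_nonneg (x := x) (y := y)).eq_or_lt with h0 | h0
  · refine ⟨0, 0, !₂[dist x z, 0], by simp [← h0], ?_, ?_⟩ <;>
      simp [EuclideanSpace.dist_eq, Fin.sum_univ_two]
    linarith
  · set p := dist x y
    set q := dist x z
    set r := dist y z
    have hq : 0 ≤ q := dist_nonneg
    have hr : 0 ≤ r := dist_nonneg
    set u := (p ^ 2 + q ^ 2 - r ^ 2) / (2 * p) with hu
    have hup : u * (2 * p) = p ^ 2 + q ^ 2 - r ^ 2 := by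
      rw [hu]; field_simp
    have hv : 0 ≤ q ^ 2 - u ^ 2 := by
      have e1 : u ≤ q := by
        rw [hu, div_le_iff₀ (by linarith)]; nlinarith
      have e2 : -q ≤ u := by
        rw [hu, le_div_iff₀ (by linarith)]; nlinarith
      nlinarith
    refine ⟨0, !₂[p, 0], !₂[u, √(q ^ 2 - u ^ 2)], ?_, ?_, ?_⟩ <;>
      simp only [EuclideanSpace.dist_eq, Fin.sum_univ_two, Real.dist_eq, sq_abs]
    · simp [Real.sqrt_sq h0.le]
    · simp [Real.sq_sqrt hv, Real.sqrt_sq hq]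
    · simp only [Matrix.cons_val_zero, Matrix.cons_val_one]
      rw [show (p - u) ^ 2 + (0 - √(q ^ 2 - u ^ 2)) ^ 2 = r ^ 2 by
        rw [zero_sub, neg_sq, Real.sq_sqrt hv]; linarith]
      exact Real.sqrt_sq hr

/-- The point dividing a chosen geodesic from `x` to `y` in the ratio `l : 1 - l`, where `l` is
clamped to the unit interval. -/
noncomputable def geoPt {X : Type*} [MetricSpace X] (h : IsGeodesicSpace X) (x y : X) (l : ℝ) :
    X :=
  (h x y).choose (max 0 (min 1 l) * dist x y)

section geoPt

variable {X : Type*} [MetricSpace X] (h : IsGeodesicSpace X)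

theorem clamp_of_mem {l : ℝ} (hl : l ∈ Set.Icc (0 : ℝ) 1) : max 0 (min 1 l) = l := by
  rw [min_eq_right hl.2, max_eq_right hl.1]

theorem clamp_mem (l : ℝ) : max 0 (min 1 l) ∈ Set.Icc (0 : ℝ) 1 :=
  ⟨le_max_left _ _, max_le zero_le_one (min_le_left _ _)⟩

theorem mul_dist_mem (x y : X) {l : ℝ} (hl : l ∈ Set.Icc (0 : ℝ) 1) :
    l * dist x y ∈ Set.Icc (0 : ℝ) (dist x y) :=
  ⟨mul_nonneg hl.1 dist_nonneg, mul_le_of_le_one_left dist_nonneg hl.2⟩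

theorem geoPt_clamp (x y : X) (l : ℝ) : geoPt h x y (max 0 (min 1 l)) = geoPt h x y l := by
  unfold geoPt; rw [clamp_of_mem (clamp_mem l)]

theorem geoPt_zero (x y : X) : geoPt h x y 0 = x := by
  unfold geoPt; simpa using (h x y).choose_spec.1

theorem geoPt_one (x y : X) : geoPt h x y 1 = y := by
  unfold geoPt; simpa using (h x y).choose_spec.2.1

theorem dist_geoPt_geoPt (x y : X) {l k : ℝ} (hl : l ∈ Set.Icc (0 : ℝ) 1)
    (hk : k ∈ Set.Icc (0 : ℝ) 1) :
    dist (geoPt h x y l) (geoPt h x y k) = |l - k| * dist x y := by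
  unfold geoPt
  rw [(h x y).choose_spec.2.2 _ (mul_dist_mem x y (clamp_mem l)) _
    (mul_dist_mem x y (clamp_mem k)), clamp_of_mem hl, clamp_of_mem hk, ← sub_mul, abs_mul,
    abs_of_nonneg dist_nonneg]

theorem dist_left_geoPt (x y : X) {l : ℝ} (hl : l ∈ Set.Icc (0 : ℝ) 1) :
    dist x (geoPt h x y l) = l * dist x y := by
  have := dist_geoPt_geoPt h x y (Set.left_mem_Icc.2 zero_le_one) hl
  rwa [geoPt_zero, zero_sub, abs_neg, abs_of_nonneg hl.1] at this

theorem dist_geoPt_right (x y : X) {l : ℝ} (hl : l ∈ Set.Icc (0 : ℝ) 1) :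
    dist (geoPt h x y l) y = (1 - l) * dist x y := by
  have := dist_geoPt_geoPt h x y hl (Set.right_mem_Icc.2 zero_le_one)
  rwa [geoPt_one, abs_sub_comm, abs_of_nonneg (sub_nonneg.2 hl.2)] at this

end geoPt

namespace IsCAT0

variable {X : Type*} [MetricSpace X] (hX : IsCAT0 X)

include hX

theorem dist_sq_geoPt_le (p x y : X) {l : ℝ} (hl : l ∈ Set.Icc (0 : ℝ) 1) :
    dist p (geoPt hX.1 x y l) ^ 2 ≤
      (1 - l) * dist p x ^ 2 + l * dist p y ^ 2 - l * (1 - l) * dist x y ^ 2 := by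
  obtain ⟨x', y', p', h1, h2, h3⟩ := exists_comparison_triangle x y p
  have key := hX.2 x y p _ _ (hX.1 x y).choose_spec (hX.1 x p).choose_spec x' y' p' h1 h2 h3
    (l * dist x y) (mul_dist_mem x y hl) (dist x p) ⟨dist_nonneg, le_rfl⟩
  rw [(hX.1 x p).choose_spec.2.1] at key
  have e1 : (hX.1 x y).choose (l * dist x y) = geoPt hX.1 x y l := by
    unfold geoPt; rw [clamp_of_mem hl]
  rw [e1] at key
  have e2 : cmpPoint (dist x p) x' p' (dist x p) = p' := by
    rcases eq_or_ne (dist x p) 0 with h0 | h0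
    · have : x' = p' := dist_eq_zero.1 (h2.trans h0)
      simp [cmpPoint, this]
    · simp [cmpPoint, div_self h0]
  have e3 : cmpPoint (dist x y) x' y' (l * dist x y) = x' + l • (y' - x') := by
    rcases eq_or_ne (dist x y) 0 with h0 | h0
    · have : x' = y' := dist_eq_zero.1 (h1.trans h0)
      simp [cmpPoint, this]
    · simp [cmpPoint, mul_div_cancel_right₀ _ h0]
  rw [e2, e3, dist_comm] at key
  have e4 : dist (x' + l • (y' - x')) p' ^ 2 =
      (1 - l) * dist x' p' ^ 2 + l * dist y' p' ^ 2 - l * (1 - l) * dist x' y' ^ 2 := by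
    simp only [EuclideanSpace.dist_eq, Fin.sum_univ_two, Real.dist_eq, sq_abs]
    rw [Real.sq_sqrt (by positivity), Real.sq_sqrt (by positivity), Real.sq_sqrt (by positivity),
      Real.sq_sqrt (by positivity)]
    simp only [PiLp.add_apply, PiLp.smul_apply, PiLp.sub_apply, smul_eq_mul]
    ring
  rw [dist_comm p x, dist_comm p y, ← h1, ← h2, ← h3, ← e4]
  exact pow_le_pow_left₀ dist_nonneg key 2

theorem eq_geoPt {x y m : X} {l : ℝ} (hl : l ∈ Set.Icc (0 : ℝ) 1)
    (h1 : dist x m = l * dist x y) (h2 : dist m y = (1 - l) * dist x y) :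
    m = geoPt hX.1 x y l := by
  have := hX.dist_sq_geoPt_le m x y hl
  rw [dist_comm m x, h1, h2] at this
  have h0 : dist m (geoPt hX.1 x y l) ^ 2 ≤ 0 := by linarith
  exact dist_eq_zero.1 (pow_eq_zero_iff two_ne_zero |>.1 (le_antisymm h0 (sq_nonneg _)))

theorem geoPt_symm (x y : X) {l : ℝ} (hl : l ∈ Set.Icc (0 : ℝ) 1) :
    geoPt hX.1 x y l = geoPt hX.1 y x (1 - l) := by
  refine hX.eq_geoPt ⟨by linarith [hl.2], by linarith [hl.1]⟩ ?_ ?_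
  · rw [dist_comm, dist_geoPt_right _ _ _ hl, dist_comm x y]
  · rw [dist_comm, dist_left_geoPt _ _ _ hl, dist_comm x y]; ring

theorem map_geoPt (g : X ≃ᵢ X) (x y : X) {l : ℝ} (hl : l ∈ Set.Icc (0 : ℝ) 1) :
    g (geoPt hX.1 x y l) = geoPt hX.1 (g x) (g y) l :=
  hX.eq_geoPt hl (by rw [g.dist_eq, g.dist_eq, dist_left_geoPt _ _ _ hl])
    (by rw [g.dist_eq, g.dist_eq, dist_geoPt_right _ _ _ hl])

theorem dist_geoPt_left_le (x y z : X) {l : ℝ} (hl : l ∈ Set.Icc (0 : ℝ) 1) :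
    dist (geoPt hX.1 x y l) (geoPt hX.1 x z l) ≤ l * dist y z := by
  have h1 := hX.dist_sq_geoPt_le (geoPt hX.1 x z l) x y hl
  have h2 := hX.dist_sq_geoPt_le y x z hl
  rw [dist_comm _ x, dist_left_geoPt _ _ _ hl, dist_comm _ y] at h1
  rw [dist_comm y x] at h2
  rw [dist_comm]
  refine abs_le_of_sq_le_sq' ?_ (mul_nonneg hl.1 dist_nonneg) |>.2
  have h3 := mul_le_mul_of_nonneg_left h2 hl.1
  nlinarith

theorem dist_geoPt_le (x y x' y' : X) {l : ℝ} (hl : l ∈ Set.Icc (0 : ℝ) 1) :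
    dist (geoPt hX.1 x y l) (geoPt hX.1 x' y' l) ≤ (1 - l) * dist x x' + l * dist y y' := by
  have hl' : 1 - l ∈ Set.Icc (0 : ℝ) 1 := ⟨by linarith [hl.2], by linarith [hl.1]⟩
  have h1 := hX.dist_geoPt_left_le x y y' hl
  have h2 := hX.dist_geoPt_left_le y' x x' hl'
  rw [← hX.geoPt_symm x y' hl, ← hX.geoPt_symm x' y' hl] at h2
  linarith [dist_triangle (geoPt hX.1 x y l) (geoPt hX.1 x y' l) (geoPt hX.1 x' y' l)]

theorem continuous_geoPt {Y : Type*} [TopologicalSpace Y] {f g : Y → X} {l : Y → ℝ}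
    (hf : Continuous f) (hg : Continuous g) (hl : Continuous l) :
    Continuous fun y => geoPt hX.1 (f y) (g y) (l y) := by
  rw [continuous_iff_continuousAt]
  intro y₀
  rw [ContinuousAt, tendsto_iff_dist_tendsto_zero]
  have hb : ∀ y, dist (geoPt hX.1 (f y) (g y) (l y)) (geoPt hX.1 (f y₀) (g y₀) (l y₀)) ≤
      dist (f y) (f y₀) + dist (g y) (g y₀) +
        |max 0 (min 1 (l y)) - max 0 (min 1 (l y₀))| * dist (f y₀) (g y₀) := by
    intro y
    rw [← geoPt_clamp _ _ _ (l y), ← geoPt_clamp _ _ _ (l y₀)]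
    have hm := clamp_mem (l y)
    have h1 := hX.dist_geoPt_le (f y) (g y) (f y₀) (g y₀) hm
    have h2 := dist_geoPt_geoPt hX.1 (f y₀) (g y₀) hm (clamp_mem (l y₀))
    have h3 := dist_triangle (geoPt hX.1 (f y) (g y) (max 0 (min 1 (l y))))
      (geoPt hX.1 (f y₀) (g y₀) (max 0 (min 1 (l y))))
      (geoPt hX.1 (f y₀) (g y₀) (max 0 (min 1 (l y₀))))
    have h4 := mul_le_mul_of_nonneg_right hm.1 (dist_nonneg (x := f y) (y := f y₀))
    have h5 := mul_le_mul_of_nonneg_right hm.2 (dist_nonneg (x := g y) (y := g y₀))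
    linarith
  refine squeeze_zero (fun _ => dist_nonneg) hb ?_
  have : Continuous fun y => dist (f y) (f y₀) + dist (g y) (g y₀) +
        |max 0 (min 1 (l y)) - max 0 (min 1 (l y₀))| * dist (f y₀) (g y₀) := by fun_prop
  simpa using this.tendsto y₀

theorem quadrilateral_le (p q r s : X) :
    dist p r ^ 2 + dist q s ^ 2 ≤
      dist p q ^ 2 + dist q r ^ 2 + dist r s ^ 2 + dist s p ^ 2 := by
  have hl : (1 / 2 : ℝ) ∈ Set.Icc (0 : ℝ) 1 := by norm_num
  have h1 := hX.dist_sq_geoPt_le q p r hl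
  have h2 := hX.dist_sq_geoPt_le s p r hl
  have h3 := dist_triangle_right q s (geoPt hX.1 p r (1 / 2))
  rw [dist_comm q p] at h1
  rw [dist_comm s r] at h2
  have h4 : dist q s ^ 2 ≤
      (dist q (geoPt hX.1 p r (1 / 2)) + dist s (geoPt hX.1 p r (1 / 2))) ^ 2 :=
    pow_le_pow_left₀ dist_nonneg h3 2
  nlinarith [sq_nonneg (dist q (geoPt hX.1 p r (1 / 2)) - dist s (geoPt hX.1 p r (1 / 2)))]

end IsCAT0

/-! ### Lines translated by an isometry -/

/-- `c` is a geodesic line along which `g` translates by `ℓ`. -/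
def IsTransLine {X : Type*} [MetricSpace X] (g : X ≃ᵢ X) (ℓ : ℝ) (c : ℝ → X) : Prop :=
  (∀ s t, dist (c s) (c t) = |s - t|) ∧ ∀ t, g (c t) = c (t + ℓ)

theorem IsometryEquiv.dist_zpow_add {X : Type*} [MetricSpace X] (g : X ≃ᵢ X) (i j : ℤ) (x y : X) :
    dist ((g ^ (i + j)) x) ((g ^ i) y) = dist ((g ^ j) x) y := by
  rw [zpow_add, IsometryEquiv.mul_apply, IsometryEquiv.dist_eq]

/-- An orbit on which an isometry moves like a translation of `ℤ` lies on a translated line. -/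
theorem exists_isTransLine {X : Type*} [MetricSpace X] (hX : IsGeodesicSpace X) (g : X ≃ᵢ X)
    (x : X) {L : ℝ} (hL : 0 < L) (h : ∀ n : ℕ, dist x ((g ^ n) x) = n * L) :
    ∃ c, IsTransLine g L c ∧ c 0 = x := by
  have h1 : dist x (g x) = L := by simpa using h 1
  have hd : ∀ i j : ℤ, i ≤ j → dist ((g ^ i) x) ((g ^ j) x) = (j - i) * L := by
    intro i j hij
    obtain ⟨n, rfl⟩ := Int.le.dest hij
    rw [dist_comm, g.dist_zpow_add, zpow_natCast, dist_comm, h]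
    push_cast; ring
  let c : ℝ → X := fun t => (g ^ ⌊t / L⌋) (geoPt hX x (g x) (t / L - ⌊t / L⌋))
  have hfr : ∀ t : ℝ, t / L - ⌊t / L⌋ ∈ Set.Icc (0 : ℝ) 1 := fun t =>
    ⟨sub_nonneg.2 (Int.floor_le _), by linarith [Int.lt_floor_add_one (t / L)]⟩
  have hl : ∀ t, dist ((g ^ ⌊t / L⌋) x) (c t) = t - ⌊t / L⌋ * L := by
    intro t
    simp only [c]
    rw [IsometryEquiv.dist_eq, dist_left_geoPt _ _ _ (hfr t), h1]
    field_simp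
  have hr : ∀ t, dist (c t) ((g ^ (⌊t / L⌋ + 1)) x) = (⌊t / L⌋ + 1) * L - t := by
    intro t
    simp only [c]
    rw [zpow_add, zpow_one, IsometryEquiv.mul_apply, IsometryEquiv.dist_eq,
      dist_geoPt_right _ _ _ (hfr t), h1]
    field_simp
    ring
  have hmono : ∀ s t, s ≤ t → dist (c s) (c t) = t - s := by
    intro s t hst
    have hf : ⌊s / L⌋ ≤ ⌊t / L⌋ := Int.floor_mono (by gcongr)
    refine le_antisymm ?_ ?_
    · rcases hf.eq_or_lt with he | hlt
      · have hs' := hfr s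
        rw [he] at hs'
        simp only [c]
        rw [he, IsometryEquiv.dist_eq, dist_geoPt_geoPt _ _ _ hs' (hfr t), h1,
          sub_sub_sub_cancel_right, ← sub_div, abs_div, abs_of_pos hL,
          div_mul_cancel₀ _ hL.ne', abs_sub_comm, abs_of_nonneg (by linarith)]
      · have e1 := dist_triangle4 (c s) ((g ^ (⌊s / L⌋ + 1)) x) ((g ^ ⌊t / L⌋) x) (c t)
        rw [hl, hr, hd _ _ (Int.add_one_le_iff.2 hlt)] at e1
        push_cast at e1
        linarith
    · have e1 := dist_triangle4 ((g ^ ⌊s / L⌋) x) (c s) (c t) ((g ^ (⌊t / L⌋ + 1)) x)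
      rw [hl, hr, hd _ _ (by omega)] at e1
      push_cast at e1
      linarith
  refine ⟨c, ⟨fun s t => ?_, fun t => ?_⟩, ?_⟩
  · rcases le_total s t with hst | hst
    · rw [hmono s t hst, abs_sub_comm, abs_of_nonneg (sub_nonneg.2 hst)]
    · rw [dist_comm, hmono t s hst, abs_of_nonneg (sub_nonneg.2 hst)]
  · have e1 : (t + L) / L = t / L + 1 := by field_simp
    simp only [c]
    rw [e1, Int.floor_add_one, ← IsometryEquiv.mul_apply, ← zpow_one_add, add_comm 1]
    congr 2
    push_cast
    ring
  · simp [c, geoPt_zero]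

theorem transLen_le {X : Type*} [MetricSpace X] (f : X → X) (x : X) :
    transLen f ≤ dist x (f x) :=
  csInf_le ⟨0, by rintro _ ⟨y, rfl⟩; exact dist_nonneg⟩ ⟨x, rfl⟩

theorem transLen_eq {X : Type*} [MetricSpace X] {f : X → X} {x : X}
    (h : ∀ y, dist x (f x) ≤ dist y (f y)) : transLen f = dist x (f x) :=
  le_antisymm (transLen_le f x)
    (le_csInf ⟨_, x, rfl⟩ (by rintro _ ⟨y, rfl⟩; exact h y))

theorem dist_pow_le {X : Type*} [MetricSpace X] (g : X ≃ᵢ X) (x : X) (n : ℕ) :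
    dist x ((g ^ n) x) ≤ n * dist x (g x) := by
  induction n with
  | zero => simp
  | succ n ih =>
    have := dist_triangle x ((g ^ n) x) ((g ^ (n + 1)) x)
    rw [pow_succ, IsometryEquiv.mul_apply, IsometryEquiv.dist_eq,
      ← IsometryEquiv.mul_apply, ← pow_succ] at this
    push_cast
    linarith

theorem le_of_forall_nat_mul_le {a b C : ℝ} (h : ∀ n : ℕ, n * a ≤ n * b + C) : a ≤ b := by
  by_contra! hlt
  obtain ⟨n, hn⟩ := exists_nat_gt (C / (a - b))
  rw [div_lt_iff₀ (by linarith)] at hn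
  linarith [h n]

/-- A point whose orbit is translated like `ℤ` realizes the translation length. -/
theorem dist_le_of_dist_pow {X : Type*} [MetricSpace X] (g : X ≃ᵢ X) (x : X) {L : ℝ}
    (h : ∀ n : ℕ, dist x ((g ^ n) x) = n * L) (y : X) : L ≤ dist y (g y) := by
  refine le_of_forall_nat_mul_le (C := 2 * dist x y) fun n => ?_
  have h1 := dist_triangle4 x y ((g ^ n) y) ((g ^ n) x)
  rw [IsometryEquiv.dist_eq, dist_comm y x, h] at h1
  linarith [dist_pow_le g y n]

namespace IsCAT0

variable {X : Type*} [MetricSpace X] (hX : IsCAT0 X)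

include hX

theorem two_mul_le_dist_sq (g : X ≃ᵢ X) {L : ℝ} (h : ∀ y, L ≤ dist y (g y)) (y : X) :
    2 * L ≤ dist y ((g ^ 2) y) := by
  have hl : (1 / 2 : ℝ) ∈ Set.Icc (0 : ℝ) 1 := by norm_num
  have h1 := hX.dist_geoPt_left_le (g y) y ((g ^ 2) y) hl
  have h2 := h (geoPt hX.1 y (g y) (1 / 2))
  rw [hX.map_geoPt g _ _ hl, hX.geoPt_symm y (g y) hl, pow_two] at *
  rw [IsometryEquiv.mul_apply] at *
  norm_num at h1 h2 ⊢
  linarith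

theorem dist_pow_eq (g : X ≃ᵢ X) {x : X} {L : ℝ} (h : ∀ y, L ≤ dist y (g y))
    (hx : dist x (g x) = L) (n : ℕ) : dist x ((g ^ n) x) = n * L := by
  have key : ∀ k : ℕ, ∀ y, 2 ^ k * L ≤ dist y ((g ^ (2 ^ k)) y) := by
    intro k
    induction k with
    | zero => simpa using h
    | succ k ih =>
      intro y
      have := hX.two_mul_le_dist_sq _ ih y
      rw [← pow_mul, ← pow_succ] at this
      rw [pow_succ]
      linarith
  refine le_antisymm (hx ▸ dist_pow_le g x n) ?_
  have h1 := key n x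
  have h2 : n ≤ 2 ^ n := Nat.lt_two_pow_self.le
  obtain ⟨r, hr⟩ := Nat.exists_eq_add_of_le h2
  have h3 := dist_triangle x ((g ^ n) x) ((g ^ (2 ^ n)) x)
  have h4 : dist ((g ^ n) x) ((g ^ (2 ^ n)) x) ≤ r * L := by
    rw [hr, pow_add, IsometryEquiv.mul_apply, IsometryEquiv.dist_eq, ← hx]
    exact dist_pow_le g x r
  have h5 : (2 ^ n : ℝ) = n + r := by exact_mod_cast hr
  rw [h5] at h1
  linarith

theorem exists_isTransLine_of_mem_minSet (g : X ≃ᵢ X) {x : X} (hx : x ∈ MinSet ⇑g)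
    (hg : 0 < transLen ⇑g) : ∃ c, IsTransLine g (transLen ⇑g) c ∧ c 0 = x :=
  exists_isTransLine hX.1 g x hg (hX.dist_pow_eq g (transLen_le _) hx)

end IsCAT0

namespace IsTransLine

variable {X : Type*} [MetricSpace X] {g : X ≃ᵢ X} {ℓ : ℝ} {c c' : ℝ → X}

theorem shift (hc : IsTransLine g ℓ c) (s : ℝ) : IsTransLine g ℓ fun t => c (s + t) :=
  ⟨fun t u => by rw [hc.1]; congr 1; ring, fun t => by rw [hc.2]; congr 1; ring⟩

theorem comp (hc : IsTransLine g ℓ c) {f : X ≃ᵢ X} (h : Commute f g) :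
    IsTransLine g ℓ fun t => f (c t) :=
  ⟨fun t u => by rw [IsometryEquiv.dist_eq, hc.1], fun t => by
    change g (f (c t)) = f (c (t + ℓ))
    rw [← hc.2, ← IsometryEquiv.mul_apply, ← h.eq, IsometryEquiv.mul_apply]⟩

theorem pow_apply (hc : IsTransLine g ℓ c) (n : ℕ) (t : ℝ) : (g ^ n) (c t) = c (t + n * ℓ) := by
  induction n with
  | zero => simp
  | succ n ih =>
    rw [pow_succ', IsometryEquiv.mul_apply, ih, hc.2]
    congr 1; push_cast; ring

theorem zpow_apply (hc : IsTransLine g ℓ c) (n : ℤ) (t : ℝ) : (g ^ n) (c t) = c (t + n * ℓ) := by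
  obtain ⟨m, rfl | rfl⟩ := n.eq_nat_or_neg
  · rw [zpow_natCast, hc.pow_apply]; simp
  · have : (g ^ (-(m : ℤ))) ((g ^ m) (c (t + ((-m : ℤ) : ℝ) * ℓ))) = c (t + ((-m : ℤ) : ℝ) * ℓ) := by
      rw [← IsometryEquiv.mul_apply, ← zpow_natCast, ← zpow_add]
      simp
    rw [hc.pow_apply] at this
    rw [← this]
    congr 2; push_cast; ring

theorem continuous (hc : IsTransLine g ℓ c) : Continuous c :=
  (Isometry.of_dist_eq fun s t => by rw [hc.1, Real.dist_eq]).continuous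

theorem geoPt_eq (hX : IsCAT0 X) (hc : IsTransLine g ℓ c) (s t : ℝ) {l : ℝ}
    (hl : l ∈ Set.Icc (0 : ℝ) 1) : geoPt hX.1 (c s) (c t) l = c ((1 - l) * s + l * t) := by
  refine (hX.eq_geoPt hl ?_ ?_).symm
  · rw [hc.1, hc.1, ← abs_of_nonneg hl.1, ← abs_mul, abs_of_nonneg hl.1]; congr 1; ring
  · have : 0 ≤ 1 - l := sub_nonneg.2 hl.2
    rw [hc.1, hc.1, ← abs_of_nonneg this, ← abs_mul, abs_of_nonneg this]; congr 1; ring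

theorem dist_const (hX : IsCAT0 X) (hℓ : 0 < ℓ) (hc : IsTransLine g ℓ c)
    (hc' : IsTransLine g ℓ c') (s t : ℝ) : dist (c s) (c' s) = dist (c t) (c' t) := by
  suffices H : ∀ s t, dist (c s) (c' s) ≤ dist (c t) (c' t) from le_antisymm (H _ _) (H _ _)
  intro s t
  have hper : ∀ n : ℤ, dist (c (t + n * ℓ)) (c' (t + n * ℓ)) = dist (c t) (c' t) := fun n => by
    rw [← hc.zpow_apply, ← hc'.zpow_apply, IsometryEquiv.dist_eq]
  set k := ⌊(s - t) / ℓ⌋ with hk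
  set l := (s - t) / ℓ - k with hldef
  have hl : l ∈ Set.Icc (0 : ℝ) 1 :=
    ⟨sub_nonneg.2 (Int.floor_le _), by linarith [Int.lt_floor_add_one ((s - t) / ℓ)]⟩
  have hs : s = (1 - l) * (t + k * ℓ) + l * (t + (k + 1 : ℤ) * ℓ) := by
    rw [hldef]; push_cast; field_simp; ring
  have := hX.dist_geoPt_le (c (t + k * ℓ)) (c (t + (k + 1 : ℤ) * ℓ)) (c' (t + k * ℓ))
    (c' (t + (k + 1 : ℤ) * ℓ)) hl
  rw [hc.geoPt_eq hX _ _ hl, hc'.geoPt_eq hX _ _ hl, ← hs, hper, hper] at this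
  linarith

theorem dist_eq_dist_zero (hX : IsCAT0 X) (hℓ : 0 < ℓ) (hc : IsTransLine g ℓ c)
    (hc' : IsTransLine g ℓ c') (s t : ℝ) : dist (c s) (c' t) = dist (c 0) (c' (t - s)) := by
  have := dist_const hX hℓ hc (hc'.shift (t - s)) s 0
  simpa using this

theorem eq_of_zero (hX : IsCAT0 X) (hℓ : 0 < ℓ) (hc : IsTransLine g ℓ c)
    (hc' : IsTransLine g ℓ c') (h : c 0 = c' 0) (t : ℝ) : c t = c' t := by
  rw [← dist_eq_zero, dist_const hX hℓ hc hc' t 0, h, dist_self]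

end IsTransLine

theorem exists_affine_of_midpoint {G : ℝ → ℝ} (hG : Continuous G)
    (h : ∀ t s, G (t + s) + G (t - s) = 2 * G t) : ∃ m, ∀ t, G t = G 0 + m * t := by
  let f : ℝ →+ ℝ :=
    { toFun := fun t => G t - G 0
      map_zero' := sub_self _
      map_add' := fun x y => by
        have h1 := h ((x + y) / 2) ((x - y) / 2)
        have h2 := h ((x + y) / 2) ((x + y) / 2)
        ring_nf at h1 h2 ⊢
        linarith }
  have hf : Continuous f := hG.sub continuous_const
  refine ⟨f 1, fun t => ?_⟩
  have := map_real_smul f hf t 1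
  simp only [smul_eq_mul, mul_one] at this
  have h3 : f t = G t - G 0 := rfl
  linarith

/-- The flat strip theorem for two lines translated by the same isometry. -/
theorem IsTransLine.flat_strip {X : Type*} [MetricSpace X] (hX : IsCAT0 X) {g : X ≃ᵢ X} {ℓ : ℝ}
    (hℓ : 0 < ℓ) {c c' : ℝ → X} (hc : IsTransLine g ℓ c) (hc' : IsTransLine g ℓ c') :
    ∃ β C, 0 ≤ C ∧ ∀ s t, dist (c s) (c' t) ^ 2 = (t - s - β) ^ 2 + C := by
  let H : ℝ → ℝ := fun t => dist (c 0) (c' t) ^ 2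
  have hH : ∀ s t, dist (c s) (c' t) ^ 2 = H (t - s) := fun s t => by
    rw [hc.dist_eq_dist_zero hX hℓ hc']
  have hHc : Continuous H := (continuous_const.dist hc'.continuous).pow 2
  obtain ⟨m, hm⟩ := exists_affine_of_midpoint (G := fun t => H t - t ^ 2)
    (hHc.sub (continuous_pow 2)) (by
      intro t s
      have h1 := hX.quadrilateral_le (c 0) (c s) (c' (t + s)) (c' t)
      have hl : (1 / 2 : ℝ) ∈ Set.Icc (0 : ℝ) 1 := by norm_num
      have h2 := hX.dist_sq_geoPt_le (c 0) (c' (t + s)) (c' (t - s)) hl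
      rw [hc'.geoPt_eq hX _ _ hl] at h2
      have e1 : (1 - 1 / 2) * (t + s) + 1 / 2 * (t - s) = t := by ring
      have e2 : t + s - s = t := by ring
      rw [dist_comm (c' t) (c 0), hH, hH, hH, hH, hc.1, hc'.1, sq_abs, sq_abs, e2] at h1
      rw [e1, hH, hH, hH, hc'.1, sq_abs] at h2
      simp only [sub_zero] at h1 h2
      nlinarith)
  refine ⟨-m / 2, H 0 - (m / 2) ^ 2, ?_, fun s t => ?_⟩
  · have h1 := hm (-m / 2)
    have h2 : 0 ≤ H (-m / 2) := sq_nonneg _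
    nlinarith
  · rw [hH]
    have h1 := hm (t - s)
    nlinarith

theorem nonpos_of_forall_le_div {a K : ℝ} (h : ∀ e : ℝ, 0 < e → a ≤ K / e) : a ≤ 0 := by
  by_contra! ha
  have hK : 0 ≤ K := by
    have := h 1 one_pos
    rw [div_one] at this; linarith
  have := h ((K + 1) / a) (by positivity)
  rw [div_div_eq_mul_div, le_div_iff₀ (by linarith)] at this
  nlinarith

/-- The offsets in the flat strips spanned by three parallel lines add up to zero. -/
theorem strip_offset_cocycle {X : Type*} [MetricSpace X] {c₁ c₂ c₃ : ℝ → X}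
    {β₁ β₂ β₃ C₁ C₂ C₃ : ℝ} (hc : ∀ s t, dist (c₁ s) (c₁ t) = |s - t|)
    (h₁ : ∀ s t, dist (c₁ s) (c₂ t) ^ 2 = (t - s - β₁) ^ 2 + C₁)
    (h₂ : ∀ s t, dist (c₂ s) (c₃ t) ^ 2 = (t - s - β₂) ^ 2 + C₂)
    (h₃ : ∀ s t, dist (c₃ s) (c₁ t) ^ 2 = (t - s - β₃) ^ 2 + C₃) :
    β₁ + β₂ + β₃ = 0 := by
  have hop : ∀ {x y : X} {e f C : ℝ}, 0 < e → dist x y ^ 2 = f ^ 2 + C → f ^ 2 = e ^ 2 →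
      dist x y ≤ e + |C| / (2 * e) := by
    intro x y e f C he h hf
    refine abs_le_of_sq_le_sq' ?_ (by positivity) |>.2
    have e1 : (e + |C| / (2 * e)) ^ 2 = e ^ 2 + |C| + (|C| / (2 * e)) ^ 2 := by
      field_simp; ring
    rw [h, hf, e1]
    nlinarith [le_abs_self C, sq_nonneg (|C| / (2 * e))]
  have main : ∀ e f : ℝ, 0 < e → f ^ 2 = e ^ 2 →
      |β₁ + β₂ + β₃ + 3 * f| ≤ 3 * e + (|C₁| + |C₂| + |C₃|) / 2 / e := by
    intro e f he hf
    have a1 := hop he (h₁ 0 (β₁ + f)) (by rw [← hf]; ring)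
    have a2 := hop he (h₂ (β₁ + f) (β₁ + β₂ + 2 * f)) (by rw [← hf]; ring)
    have a3 := hop he (h₃ (β₁ + β₂ + 2 * f) (β₁ + β₂ + β₃ + 3 * f)) (by rw [← hf]; ring)
    have a4 := dist_triangle4 (c₁ 0) (c₂ (β₁ + f)) (c₃ (β₁ + β₂ + 2 * f))
      (c₁ (β₁ + β₂ + β₃ + 3 * f))
    rw [hc, zero_sub, abs_neg] at a4
    have : (|C₁| + |C₂| + |C₃|) / 2 / e = |C₁| / (2 * e) + |C₂| / (2 * e) + |C₃| / (2 * e) := by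
      field_simp
    linarith
  refine le_antisymm (nonpos_of_forall_le_div (K := (|C₁| + |C₂| + |C₃|) / 2) fun e he => ?_)
    (neg_nonpos.1 (nonpos_of_forall_le_div (K := (|C₁| + |C₂| + |C₃|) / 2) fun e he => ?_))
  · linarith [(abs_le.1 (main e e he rfl)).2]
  · linarith [(abs_le.1 (main e (-e) he (by ring))).1]

/-! ### Splitting of the minset of a hyperbolic isometry -/

theorem eq_of_forall_sq_add {x y C C' : ℝ} (h : ∀ t, (x - t) ^ 2 + C = (y - t) ^ 2 + C') :
    x = y ∧ C = C' := by
  have h0 := h 0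
  have h1 := h 1
  have : x = y := by nlinarith
  subst this
  exact ⟨rfl, by linarith⟩

/-- The lines translated by `g` admit a common height function, turning the distance
between two of them into the Euclidean distance of a flat strip. -/
theorem exists_height {X : Type*} [MetricSpace X] (hX : IsCAT0 X) {g : X ≃ᵢ X} {ℓ : ℝ}
    (hℓ : 0 < ℓ) {o : ℝ → X} (ho : IsTransLine g ℓ o) :
    ∃ (b : {c // IsTransLine g ℓ c} → ℝ)
      (C : {c // IsTransLine g ℓ c} → {c // IsTransLine g ℓ c} → ℝ), ∀ c c', 0 ≤ C c c' ∧
        ∀ s t, dist (c.1 s) (c'.1 t) ^ 2 = (b c + s - b c' - t) ^ 2 + C c c' := by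
  choose β C hC h using fun c c' : {c // IsTransLine g ℓ c} => c.2.flat_strip hX hℓ c'.2
  have hco : ∀ c c' c'', β c c' + β c' c'' + β c'' c = 0 := fun c c' c'' =>
    strip_offset_cocycle c.2.1 (h c c') (h c' c'') (h c'' c)
  refine ⟨fun c => β c ⟨o, ho⟩, C, fun c c' => ⟨hC c c', fun s t => ?_⟩⟩
  rw [h]
  have h1 := hco c c' ⟨o, ho⟩
  have h2 := hco c c ⟨o, ho⟩
  have h3 := hco c c c
  have : β c c' = β c ⟨o, ho⟩ - β c' ⟨o, ho⟩ := by linarith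
  rw [this]
  ring

theorem isGeodesicSpace_of_inclusion {X T : Type*} [MetricSpace X] [MetricSpace T]
    (hX : IsGeodesicSpace X) (f : T → X) (hf : Isometry f)
    (h : ∀ p q, ∀ l ∈ Set.Icc (0 : ℝ) 1, ∃ m, f m = geoPt hX (f p) (f q) l) :
    IsGeodesicSpace T := by
  intro p q
  choose γ hγ using fun l : ℝ => h p q _ (clamp_mem l)
  simp only [geoPt_clamp] at hγ
  have key : ∀ s ∈ Set.Icc (0 : ℝ) (dist p q), ∀ t ∈ Set.Icc (0 : ℝ) (dist p q),
      dist (γ (s / dist p q)) (γ (t / dist p q)) = |s - t| := by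
    intro s hs t ht
    rcases (dist_nonneg (x := p) (y := q)).eq_or_lt with h0 | h0
    · rw [← h0] at hs ht ⊢
      rw [Set.Icc_self, Set.mem_singleton_iff] at hs ht
      simp [hs, ht]
    · have hmem : ∀ u ∈ Set.Icc (0 : ℝ) (dist p q), u / dist p q ∈ Set.Icc (0 : ℝ) 1 :=
        fun u hu => ⟨div_nonneg hu.1 h0.le, (div_le_one h0).2 hu.2⟩
      rw [← hf.dist_eq, hγ, hγ, dist_geoPt_geoPt _ _ _ (hmem s hs) (hmem t ht), hf.dist_eq,
        ← sub_div, abs_div, abs_of_pos h0, div_mul_cancel₀ _ h0.ne']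
  refine ⟨fun s => γ (s / dist p q), hf.injective ?_, hf.injective ?_, key⟩
  · rw [hγ, zero_div, geoPt_zero]
  · rw [hγ]
    rcases eq_or_ne p q with rfl | hne
    · refine dist_le_zero.1 ?_
      have := dist_left_geoPt hX (f p) (f p) (clamp_mem (dist p p / dist p p))
      rw [geoPt_clamp, dist_self (f p), mul_zero, dist_comm] at this
      exact this.le
    · rw [div_self (dist_ne_zero.2 hne), geoPt_one]

/-- The union of the axes of a hyperbolic isometry `z` of a CAT(0) space splits as the
product of a geodesic space with `ℝ`, and the centralizer of `z` respects the splitting. -/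
theorem exists_splitting.{u} {X : Type u} [MetricSpace X] (hX : IsCAT0 X) {z : X ≃ᵢ X}
    (hz : 0 < transLen ⇑z) (hne : (MinSet ⇑z).Nonempty) :
    ∃ (T : Type u) (_ : MetricSpace T) (F : T → ℝ → X), Nonempty T ∧ IsGeodesicSpace T ∧
      (∀ p q s t, dist (F p s) (F q t) ^ 2 = dist p q ^ 2 + (s - t) ^ 2) ∧
      (∀ p, IsTransLine z (transLen ⇑z) (F p)) ∧
      (∀ c, IsTransLine z (transLen ⇑z) c → ∃ p r, ∀ t, c t = F p (t + r)) ∧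
      (∀ f, Commute f z → ∃ (ψ : T ≃ᵢ T) (α : ℝ), ∀ p t, f (F p t) = F (ψ p) (t + α)) := by
  set ℓ := transLen ⇑z with hℓdef
  have hmin : ∀ x, dist x (z x) ≤ ℓ → ∃ c, IsTransLine z ℓ c ∧ c 0 = x := fun x hx =>
    hX.exists_isTransLine_of_mem_minSet z (le_antisymm hx (transLen_le _ x)) hz
  obtain ⟨x₀, hx₀⟩ := hne
  obtain ⟨o, ho, -⟩ := hmin x₀ (le_of_eq hx₀)
  obtain ⟨b, C, hbC⟩ := exists_height hX hz ho
  have hd := fun c c' => (hbC c c').2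
  have hshift : ∀ c r, b ⟨_, (c.2).shift r⟩ = b c + r := by
    intro c r
    have := eq_of_forall_sq_add (x := b ⟨_, (c.2).shift r⟩ - b c) (y := r)
      (C := C ⟨_, (c.2).shift r⟩ c) (C' := C c c) fun t => by
        have h1 := hd ⟨_, (c.2).shift r⟩ c 0 t
        have h2 := hd c c r t
        simp only [add_zero] at h1
        rw [h1] at h2
        nlinarith
    linarith [this.1]
  let T := {c : {c // IsTransLine z ℓ c} // b c = 0}
  let i : T → X := fun c => c.1.1 0
  have hi : Function.Injective i := fun c c' h =>
    Subtype.ext (Subtype.ext (funext (c.1.2.eq_of_zero hX hz c'.1.2 h)))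
  let _ : MetricSpace T := MetricSpace.induced i hi inferInstance
  have hii : Isometry i := Isometry.of_dist_eq fun _ _ => rfl
  have hDT : ∀ p q : T, dist p q ^ 2 = C p.1 q.1 := fun p q => by
    rw [← hii.dist_eq]
    simp only [i, hd, p.2, q.2]
    ring
  have hF : ∀ (p q : T) (s t : ℝ), dist (p.1.1 s) (q.1.1 t) ^ 2 = dist p q ^ 2 + (s - t) ^ 2 := by
    intro p q s t
    rw [hDT, hd, p.2, q.2]
    ring
  have hline : ∀ c, IsTransLine z ℓ c → ∃ (p : T) (r : ℝ), ∀ t, c t = p.1.1 (t + r) := by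
    intro c hc
    refine ⟨⟨⟨_, hc.shift (-b ⟨c, hc⟩)⟩, ?_⟩, b ⟨c, hc⟩, fun t => ?_⟩
    · rw [hshift ⟨c, hc⟩, add_neg_cancel]
    · simp
  have hequi : ∀ f, Commute f z → ∃ (ψ : T → T) (α : ℝ),
      ∀ p t, f (p.1.1 t) = (ψ p).1.1 (t + α) := by
    intro f hf
    choose ψ r hr using fun p : T => hline _ (p.1.2.comp hf)
    obtain ⟨q, -⟩ := hline o ho
    refine ⟨ψ, r q, fun p t => ?_⟩
    have := eq_of_forall_sq_add (x := r p - r q) (y := 0)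
      (C := dist (ψ p) (ψ q) ^ 2) (C' := dist p q ^ 2) fun t => by
        have h1 := hF (ψ p) (ψ q) (0 + r p) (t + r q)
        rw [← hr, ← hr, f.dist_eq, hF] at h1
        nlinarith
    rw [hr, sub_eq_zero.1 this.1]
  have hinj : ∀ (p q : T) (s : ℝ), p.1.1 s = q.1.1 s → p = q := by
    intro p q s h
    have := hF p q s s
    rw [h, dist_self] at this
    exact dist_eq_zero.1 (pow_eq_zero_iff two_ne_zero |>.1 (by linarith))
  refine ⟨T, inferInstance, fun c => c.1.1, ?_, ?_, hF, fun p => p.1.2, hline, ?_⟩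
  · obtain ⟨p, -⟩ := hline o ho
    exact ⟨p⟩
  · refine isGeodesicSpace_of_inclusion hX.1 i hii fun p q l hl => ?_
    have hm : dist (geoPt hX.1 (i p) (i q) l) (z (geoPt hX.1 (i p) (i q) l)) ≤ ℓ := by
      rw [hX.map_geoPt z _ _ hl]
      refine (hX.dist_geoPt_le _ _ _ _ hl).trans_eq ?_
      simp only [i, p.1.2.2, q.1.2.2, p.1.2.1, q.1.2.1, zero_add, zero_sub, abs_neg, abs_of_pos hz]
      ring
    obtain ⟨c, hc, hc0⟩ := hmin _ hm
    obtain ⟨m, r, hr⟩ := hline c hc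
    have hr0 := hr 0
    rw [hc0, zero_add] at hr0
    have h1 := dist_left_geoPt hX.1 (i p) (i q) hl
    have h2 := dist_geoPt_right hX.1 (i p) (i q) hl
    rw [hr0, hii.dist_eq p q] at h1 h2
    have h3 : dist (i p) (m.1.1 r) ^ 2 = _ := hF p m 0 r
    have h4 : dist (m.1.1 r) (i q) ^ 2 = _ := hF m q r 0
    rw [h1] at h3
    rw [h2] at h4
    have h5 := dist_triangle p m q
    have h6 : dist p m ≤ l * dist p q :=
      abs_le_of_sq_le_sq' (by nlinarith [sq_nonneg (0 - r)]) (mul_nonneg hl.1 dist_nonneg) |>.2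
    have h7 : dist m q ≤ (1 - l) * dist p q :=
      abs_le_of_sq_le_sq' (by nlinarith [sq_nonneg (r - 0)])
        (mul_nonneg (sub_nonneg.2 hl.2) dist_nonneg) |>.2
    have h8 : dist p m = l * dist p q := by linarith
    have h9 : r = 0 := by
      rw [h8] at h3
      have : (0 - r) ^ 2 = 0 := by linarith
      simpa using this
    exact ⟨m, by rw [hr0, h9]⟩
  · intro f hf
    obtain ⟨ψ, α, hψ⟩ := hequi f hf
    obtain ⟨ψ', α', hψ'⟩ := hequi f⁻¹ hf.inv_left
    have hα : α + α' = 0 := by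
      obtain ⟨p, -⟩ := hline o ho
      have h1 : f⁻¹ (f (p.1.1 0)) = p.1.1 0 := f.inv_apply_self _
      have h2 := hF p (ψ' (ψ p)) 0 (0 + α + α')
      rw [← hψ', ← hψ, h1, dist_self] at h2
      nlinarith [sq_nonneg (dist p (ψ' (ψ p))), sq_nonneg (α + α')]
    have h12 : ∀ p, ψ' (ψ p) = p := fun p => hinj _ _ 0 <| by
      have h1 : f⁻¹ (f (p.1.1 0)) = p.1.1 0 := f.inv_apply_self _
      rw [hψ, hψ', add_assoc, hα, add_zero] at h1
      exact h1
    have h21 : ∀ p, ψ (ψ' p) = p := fun p => hinj _ _ 0 <| by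
      have h1 : f (f⁻¹ (p.1.1 0)) = p.1.1 0 := f.apply_inv_self _
      rw [hψ', hψ, add_assoc, add_comm α' α, hα, add_zero] at h1
      exact h1
    refine ⟨⟨⟨ψ, ψ', h12, h21⟩, Isometry.of_dist_eq fun p q => ?_⟩, α, hψ⟩
    have h1 := hF (ψ p) (ψ q) (0 + α) (0 + α)
    rw [← hψ, ← hψ, f.dist_eq, hF] at h1
    exact (pow_left_inj₀ dist_nonneg dist_nonneg two_ne_zero).1 (by linarith)

/-- A geodesic factor of a flat direction in a CAT(0) space of dimension at most two
is an `ℝ`-tree. -/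
theorem isRTree_of_splitting {X T : Type*} [MetricSpace X] [MetricSpace T] (hX : IsCAT0 X)
    (hdim : CovDimLE X 2) (hT : IsGeodesicSpace T) {F : T → ℝ → X}
    (hF : ∀ p q s t, dist (F p s) (F q t) ^ 2 = dist p q ^ 2 + (s - t) ^ 2) : IsRTree T := by
  have hi : Isometry fun p => F p 0 := Isometry.of_dist_eq fun p q =>
    (pow_left_inj₀ dist_nonneg dist_nonneg two_ne_zero).1 (by rw [hF]; ring)
  have hgeo : ∀ x y l, F (geoPt hT x y l) 0 = geoPt hX.1 (F x 0) (F y 0) l := by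
    intro x y l
    rw [← geoPt_clamp, ← geoPt_clamp hX.1]
    refine hX.eq_geoPt (clamp_mem l) ?_ ?_
    · rw [hi.dist_eq, hi.dist_eq, dist_left_geoPt _ _ _ (clamp_mem l)]
    · rw [hi.dist_eq, hi.dist_eq, dist_geoPt_right _ _ _ (clamp_mem l)]
  have hFc : Continuous fun x : T × ℝ => F x.1 x.2 := by
    rw [continuous_iff_continuousAt]
    intro x₀
    rw [ContinuousAt, tendsto_iff_dist_tendsto_zero]
    have h1 : ∀ x : T × ℝ, dist (F x.1 x.2) (F x₀.1 x₀.2) =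
        Real.sqrt (dist x.1 x₀.1 ^ 2 + (x.2 - x₀.2) ^ 2) := fun x => by
      rw [← hF, Real.sqrt_sq dist_nonneg]
    simp only [h1]
    have h2 : Continuous fun x : T × ℝ => Real.sqrt (dist x.1 x₀.1 ^ 2 + (x.2 - x₀.2) ^ 2) := by
      fun_prop
    simpa using h2.tendsto x₀
  refine ⟨hT, fun p r q s => ?_⟩
  let G : ℝ → ℝ → T := fun u v => geoPt hT (geoPt hT p q u) (geoPt hT s r u) v
  have hG : Continuous fun y : Fin 3 → ℝ => G (y 0) (y 1) := by
    rw [hi.isEmbedding.continuous_iff]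
    simp only [G, Function.comp_def, hgeo]
    refine hX.continuous_geoPt (hX.continuous_geoPt ?_ ?_ ?_) (hX.continuous_geoPt ?_ ?_ ?_) ?_ <;>
      fun_prop
  obtain ⟨i, x, hx, y, hy, hxi, hyi, hxy⟩ := hdim.exists_opposite_faces_meet
    (fun y => F (G (y 0) (y 1)) (y 2)) (hFc.comp (hG.prodMk (continuous_apply 2)))
  have hm : ∀ {x : Fin 3 → ℝ}, x ∈ Set.Icc (0 : Fin 3 → ℝ) 1 → ∀ j, x j ∈ Set.Icc (0 : ℝ) 1 :=
    fun hx j => ⟨hx.1 j, hx.2 j⟩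
  have hsum : ∀ x y : T, ∀ {l : ℝ}, l ∈ Set.Icc (0 : ℝ) 1 →
      dist x (geoPt hT x y l) + dist (geoPt hT x y l) y = dist x y := fun x y l hl => by
    rw [dist_left_geoPt _ _ _ hl, dist_geoPt_right _ _ _ hl]; ring
  have h0 := hF (G (x 0) (x 1)) (G (y 0) (y 1)) (x 2) (y 2)
  rw [hxy, dist_self] at h0
  have hGxy : G (x 0) (x 1) = G (y 0) (y 1) := by
    refine dist_eq_zero.1 (pow_eq_zero_iff two_ne_zero |>.1 (le_antisymm ?_ (sq_nonneg _)))
    nlinarith [sq_nonneg (x 2 - y 2)]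
  have hswap : ∀ {a b c d o : T}, dist a o + dist o b = dist a b → dist c o + dist o d = dist c d →
      dist a d + dist c b ≤ dist a b + dist c d := fun {a b c d o} h1 h2 => by
    linarith [dist_triangle a o d, dist_triangle c o b]
  fin_cases i
  · simp only [Fin.zero_eta] at hxi hyi
    rw [hxi, hyi] at hGxy
    simp only [G, geoPt_zero, geoPt_one] at hGxy
    have h1 := hsum q r (hm hy 1)
    rw [← hGxy] at h1
    have h2 := hswap (hsum p s (hm hx 1)) h1
    rw [dist_comm q r] at h2
    exact h2.trans (le_max_right _ _)
  · simp only [Fin.mk_one] at hxi hyi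
    rw [hxi, hyi] at hGxy
    simp only [G, geoPt_zero, geoPt_one] at hGxy
    have h1 := hsum s r (hm hy 0)
    rw [← hGxy] at h1
    have h2 := hswap (hsum p q (hm hx 0)) h1
    rw [dist_comm s q, dist_comm s r] at h2
    exact h2.trans (le_max_left _ _)
  · simp only [Fin.reduceFinMk] at hxi hyi
    rw [hxi, hyi] at h0
    nlinarith [sq_nonneg (dist (G (x 0) (x 1)) (G (y 0) (y 1)))]

/-! ### Isometries of `ℝ`-trees -/

namespace IsRTree

variable {T : Type*} [MetricSpace T] (hT : IsRTree T)

include hT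

theorem four_point (x y z w : T) :
    dist x y + dist z w ≤ dist x z + dist y w ∨ dist x y + dist z w ≤ dist x w + dist y z :=
  le_max_iff.1 (hT.2 x y z w)

theorem eq_of_between {x y u v : T} (hu : dist x u + dist u y = dist x y)
    (hv : dist x v + dist v y = dist x y) (h : dist x u = dist x v) : u = v := by
  refine dist_le_zero.1 ?_
  have h1 := dist_comm u y
  have h2 := dist_comm v y
  rcases hT.four_point x y u v with h' | h' <;> linarith

theorem dist_lt_dist_sq {g : T ≃ᵢ T} (hg : ∀ x, g x ≠ x) (x : T) :
    dist x (g x) < dist x ((g ^ 2) x) := by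
  by_contra! hle
  have hl : (1 / 2 : ℝ) ∈ Set.Icc (0 : ℝ) 1 := by norm_num
  have h1 := dist_left_geoPt hT.1 x (g x) hl
  have h2 := dist_geoPt_right hT.1 x (g x) hl
  set m := geoPt hT.1 x (g x) (1 / 2)
  refine hg m (dist_le_zero.1 ?_)
  rw [pow_two, IsometryEquiv.mul_apply] at hle
  have h3 := g.dist_eq x (g x)
  have h4 := g.dist_eq x m
  have h5 := g.dist_eq m (g x)
  have h6 := dist_comm m (g (g x))
  have h7 := dist_comm m (g m)
  have h8 := dist_comm m x
  have h9 := dist_comm x (g (g x))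
  have h10 := dist_comm (g x) (g (g x))
  have h11 := dist_comm (g (g x)) (g m)
  have h12 := dist_comm (g x) (g m)
  rcases hT.four_point m (g (g x)) x (g x) with h | h <;>
  rcases hT.four_point m (g m) (g x) (g (g x)) with h' | h' <;> linarith

theorem dist_pow_succ {g : T ≃ᵢ T} (hg : ∀ x, g x ≠ x) (x : T) (n : ℕ) :
    dist x ((g ^ (n + 1)) x) =
      dist x (g x) + n * (dist x ((g ^ 2) x) - dist x (g x)) := by
  suffices H : ∀ n : ℕ, dist x ((g ^ (n + 1)) x) =
        dist x (g x) + n * (dist x ((g ^ 2) x) - dist x (g x)) ∧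
      dist x ((g ^ (n + 2)) x) =
        dist x (g x) + (n + 1) * (dist x ((g ^ 2) x) - dist x (g x)) from (H n).1
  intro n
  induction n with
  | zero => simp
  | succ n ih =>
    refine ⟨by rw [ih.2]; push_cast; ring, ?_⟩
    have hlt := hT.dist_lt_dist_sq hg x
    have e : ∀ k, (g ^ (k + 1)) x = g ((g ^ k) x) := fun k => by
      rw [pow_succ', IsometryEquiv.mul_apply]
    have e1 := g.dist_eq x ((g ^ (n + 2)) x)
    have e2 := g.dist_eq x ((g ^ (n + 1)) x)
    rw [← e] at e1 e2
    have e3 : dist ((g ^ (n + 2)) x) ((g ^ (n + 2 + 1)) x) = dist x (g x) := by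
      rw [pow_succ _ (n + 2), IsometryEquiv.mul_apply, IsometryEquiv.dist_eq]
    have f1 := hT.four_point x ((g ^ (n + 2)) x) (g x) ((g ^ (n + 2 + 1)) x)
    have f2 := hT.four_point x ((g ^ (n + 2 + 1)) x) (g x) ((g ^ (n + 2)) x)
    have c1 := dist_comm ((g ^ (n + 2)) x) (g x)
    have c2 := dist_comm ((g ^ (n + 2 + 1)) x) (g x)
    have c3 := dist_comm ((g ^ (n + 2 + 1)) x) ((g ^ (n + 2)) x)
    have hpos : 0 < ((n : ℝ) + 1) * (dist x ((g ^ 2) x) - dist x (g x)) :=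
      mul_pos (by positivity) (by linarith)
    have : n + 1 + 2 = n + 2 + 1 := by ring
    rw [this]
    push_cast
    rcases f1 with f1 | f1 <;> rcases f2 with f2 | f2 <;> nlinarith

theorem mem_axis_aux {g : T ≃ᵢ T} {x u : T}
    (hu : dist x u + dist u (g x) = dist x (g x))
    (h1 : dist x (g x) - (dist x ((g ^ 2) x) - dist x (g x)) ≤ 2 * dist u (g x))
    (h2 : 2 * dist u (g x) ≤ dist x (g x) + (dist x ((g ^ 2) x) - dist x (g x))) :
    dist u (g u) ≤ dist x ((g ^ 2) x) - dist x (g x) := by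
  rw [pow_two, IsometryEquiv.mul_apply] at *
  have h3 := g.dist_eq x (g x)
  have h4 := g.dist_eq x u
  have h5 := g.dist_eq u (g x)
  have h8 := dist_comm u x
  have h9 := dist_comm x (g (g x))
  have h10 := dist_comm (g x) (g (g x))
  have h11 := dist_comm (g (g x)) (g u)
  have h12 := dist_comm (g x) (g u)
  rcases hT.four_point u (g (g x)) x (g x) with h | h <;>
  rcases hT.four_point u (g u) (g x) (g (g x)) with h' | h' <;> linarith

theorem sub_dist_le {g : T ≃ᵢ T} (hg : ∀ x, g x ≠ x) (x y : T) :
    dist x ((g ^ 2) x) - dist x (g x) ≤ dist y (g y) := by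
  refine le_of_forall_nat_mul_le (C := 2 * dist x y + dist y (g y)) fun n => ?_
  have h1 := dist_triangle4 x y ((g ^ (n + 1)) y) ((g ^ (n + 1)) x)
  rw [IsometryEquiv.dist_eq, dist_comm y x, hT.dist_pow_succ hg] at h1
  have h2 := dist_pow_le g y (n + 1)
  push_cast at h2
  linarith [dist_nonneg (x := x) (y := g x)]

theorem sub_dist_eq {g : T ≃ᵢ T} (hg : ∀ x, g x ≠ x) (x : T) :
    dist x ((g ^ 2) x) - dist x (g x) = transLen ⇑g := by
  have hl : (1 / 2 : ℝ) ∈ Set.Icc (0 : ℝ) 1 := by norm_num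
  have h1 := dist_left_geoPt hT.1 x (g x) hl
  have h2 := dist_geoPt_right hT.1 x (g x) hl
  have h3 := hT.dist_lt_dist_sq hg x
  set m := geoPt hT.1 x (g x) (1 / 2)
  have h4 := hT.mem_axis_aux (x := x) (u := m) (by linarith)
    (by linarith) (by linarith)
  have h5 := hT.sub_dist_le hg x
  rw [transLen_eq fun y => h4.trans (h5 y)]
  exact le_antisymm (h5 _) h4

theorem transLen_pos {g : T ≃ᵢ T} (hg : ∀ x, g x ≠ x) (x : T) : 0 < transLen ⇑g := by
  rw [← hT.sub_dist_eq hg x]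
  linarith [hT.dist_lt_dist_sq hg x]

/-- The central part of a segment `[x, g x]` lies on the axis of `g`. -/
theorem mem_minSet {g : T ≃ᵢ T} (hg : ∀ x, g x ≠ x) {x u : T}
    (hu : dist x u + dist u (g x) = dist x (g x))
    (h1 : dist x (g x) - transLen ⇑g ≤ 2 * dist u (g x))
    (h2 : 2 * dist u (g x) ≤ dist x (g x) + transLen ⇑g) : u ∈ MinSet ⇑g := by
  refine le_antisymm ?_ (transLen_le _ _)
  rw [← hT.sub_dist_eq hg x] at *
  exact hT.mem_axis_aux hu h1 h2

theorem exists_isTransLine_of_mem_minSet {g : T ≃ᵢ T} (hg : ∀ x, g x ≠ x) {x : T}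
    (hx : x ∈ MinSet ⇑g) : ∃ c, IsTransLine g (transLen ⇑g) c ∧ c 0 = x := by
  refine exists_isTransLine hT.1 g x (hT.transLen_pos hg x) fun n => ?_
  rcases n with _ | n
  · simp
  · rw [hT.dist_pow_succ hg, hT.sub_dist_eq hg, show dist x (g x) = _ from hx]
    push_cast; ring

/-- The axis of `g` is a single line. -/
theorem mem_range_of_mem_minSet {g : T ≃ᵢ T} (hg : ∀ x, g x ≠ x) {c : ℝ → T}
    (hc : IsTransLine g (transLen ⇑g) c) {x : T} (hx : x ∈ MinSet ⇑g) : x ∈ Set.range c := by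
  obtain ⟨c', hc', rfl⟩ := hT.exists_isTransLine_of_mem_minSet hg hx
  have hL := hT.transLen_pos hg (c 0)
  set L := transLen ⇑g
  obtain ⟨n, hn⟩ := exists_nat_gt (dist (c 0) (c' 0) / L)
  rw [div_lt_iff₀ hL] at hn
  set r : ℝ := n * L with hr
  have hper : ∀ k : ℤ, dist (c (k * L)) (c' (k * L)) = dist (c 0) (c' 0) := fun k => by
    have h1 := hc.zpow_apply k 0
    have h2 := hc'.zpow_apply k 0
    rw [zero_add] at h1 h2
    rw [← h1, ← h2, IsometryEquiv.dist_eq]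
  have p1 := hper n
  have p2 := hper (-n)
  push_cast at p1 p2
  rw [neg_mul] at p2
  rw [← hr] at p1 p2
  have hr0 : 0 < r := dist_nonneg.trans_lt hn
  have d1 : dist (c' (-r)) (c' 0) = r := by
    rw [hc'.1, sub_zero, abs_neg, abs_of_pos hr0]
  have d2 : dist (c' r) (c' 0) = r := by
    rw [hc'.1, sub_zero, abs_of_pos hr0]
  have d3 : dist (c' (-r)) (c' r) = 2 * r := by
    rw [hc'.1, abs_sub_comm, sub_neg_eq_add, abs_of_pos (by linarith)]; ring
  have d4 : dist (c (-r)) (c r) = 2 * r := by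
    rw [hc.1, abs_sub_comm, sub_neg_eq_add, abs_of_pos (by linarith)]; ring
  have hb : dist (c (-r)) (c' 0) + dist (c' 0) (c r) = dist (c (-r)) (c r) := by
    refine le_antisymm ?_ (dist_triangle _ _ _)
    have f1 := hT.four_point (c (-r)) (c' 0) (c' (-r)) (c' r)
    have f2 := hT.four_point (c r) (c' 0) (c' r) (c (-r))
    rw [dist_comm (c' 0) (c' r), dist_comm (c' 0) (c' (-r))] at f1
    rw [dist_comm (c' 0) (c' r), dist_comm (c' 0) (c (-r)), dist_comm (c' r) (c (-r)),
      dist_comm (c r) (c (-r))] at f2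
    rw [dist_comm (c' 0) (c r)]
    have n1 := dist_nonneg (x := c (-r)) (y := c' 0)
    have n2 := dist_nonneg (x := c r) (y := c' 0)
    have n3 := dist_triangle (c (-r)) (c' 0) (c' r)
    rw [dist_comm (c' 0)] at n3
    rcases f1 with f1 | f1 <;> rcases f2 with f2 | f2 <;> linarith
  have h0 : 0 ≤ dist (c (-r)) (c' 0) := dist_nonneg
  have h1 : 0 ≤ dist (c' 0) (c r) := dist_nonneg
  refine ⟨dist (c (-r)) (c' 0) - r, hT.eq_of_between ?_ hb ?_⟩
  · rw [hc.1, hc.1, d4, abs_of_nonpos (by linarith), abs_of_nonpos (by linarith)]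
    ring
  · rw [hc.1, abs_of_nonpos (by linarith)]
    ring

end IsRTree

theorem affine_of_isometric_ray {k : ℝ → ℝ} {s₀ : ℝ}
    (hk : ∀ s, s₀ ≤ s → ∀ t, s₀ ≤ t → |k s - k t| = |s - t|) :
    ∃ σ : ℝ, (σ = 1 ∨ σ = -1) ∧ ∀ t, s₀ ≤ t → k t = k s₀ + σ * (t - s₀) := by
  have h1 := hk (s₀ + 1) (by linarith) s₀ le_rfl
  rw [add_sub_cancel_left, abs_one] at h1
  refine ⟨k (s₀ + 1) - k s₀, (abs_eq zero_le_one).1 h1, fun t ht => ?_⟩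
  have h2 := hk t ht s₀ le_rfl
  have h3 := hk t ht (s₀ + 1) (by linarith)
  rw [abs_of_nonneg (by linarith : 0 ≤ t - s₀)] at h2
  rw [← sq_eq_sq₀ (abs_nonneg _) (abs_nonneg _), sq_abs, sq_abs] at h3
  rcases (abs_eq zero_le_one).1 h1 with h1 | h1 <;>
  rcases (abs_eq (by linarith)).1 h2 with h2 | h2 <;>
  · rw [h1]
    nlinarith

/-- If the axes of `a` and `b` share a ray and `a * b` has a fixed point, then `a * b`
fixes infinitely many points of an `a`-orbit. -/
theorem exists_infinite_fixed_of_ray {T : Type*} [MetricSpace T] {a b : T ≃ᵢ T} {p : T}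
    (hp : a (b p) = p) {κ L s₀ : ℝ} {c c' : ℝ → T} (hκ : κ ≠ 0) (hc : IsTransLine a κ c)
    (hc' : IsTransLine b L c') (h : ∀ t, s₀ ≤ t → c t ∈ Set.range c') :
    ∃ x, {n : ℤ | a (b ((a ^ n) x)) = (a ^ n) x}.Infinite := by
  choose! k hk using h
  obtain ⟨σ, hσ, hkσ⟩ := affine_of_isometric_ray (k := k) (s₀ := s₀) fun s hs t ht => by
    rw [← hc'.1, hk s hs, hk t ht, hc.1]
  have hb : ∀ t, s₀ + |L| ≤ t → a (b (c t)) = c (t + (σ * L + κ)) := by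
    intro t ht
    have h1 : s₀ ≤ t := by linarith [abs_nonneg L]
    have h2 : s₀ ≤ t + σ * L := by
      rcases hσ with rfl | rfl
      · linarith [neg_abs_le L]
      · linarith [le_abs_self L]
    have h3 : k t + L = k (t + σ * L) := by
      rw [hkσ t h1, hkσ _ h2]
      rcases hσ with rfl | rfl <;> ring
    rw [← hk t h1, hc'.2, h3, hk _ h2, hc.2, add_assoc]
  have hdist : ∀ t, s₀ + |L| ≤ t → dist p (c t) = dist p (c (t + (σ * L + κ))) := fun t ht => by
    rw [← hb t ht]
    nth_rewrite 2 [← hp]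
    rw [IsometryEquiv.dist_eq, IsometryEquiv.dist_eq]
  have hdist' : ∀ t, s₀ + |L| ≤ t → dist p (c (t + |σ * L + κ|)) = dist p (c t) := by
    intro t ht
    rcases abs_cases (σ * L + κ) with ⟨h1, h2⟩ | ⟨h1, h2⟩
    · rw [h1, hdist t ht]
    · rw [h1, hdist _ (by linarith), neg_add_cancel_right]
  have hiter : ∀ n : ℕ, dist p (c (s₀ + |L| + n * |σ * L + κ|)) = dist p (c (s₀ + |L|)) := by
    intro n
    induction n with
    | zero => simp
    | succ n ih =>
      rw [← ih, ← hdist' (s₀ + |L| + n * |σ * L + κ|)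
        (by linarith [mul_nonneg (n.cast_nonneg (α := ℝ)) (abs_nonneg (σ * L + κ))])]
      congr 2; push_cast; ring
  have hzero : σ * L + κ = 0 := by
    refine abs_nonpos_iff.1 (le_of_forall_nat_mul_le (C := 2 * dist p (c (s₀ + |L|))) fun n => ?_)
    have h1 := dist_triangle_left (c (s₀ + |L| + n * |σ * L + κ|)) (c (s₀ + |L|)) p
    rw [hiter, hc.1, add_sub_cancel_left, abs_of_nonneg (by positivity)] at h1
    linarith
  simp only [hzero, add_zero] at hb
  refine ⟨c (s₀ + |L|), ?_⟩
  have hmem : ∀ n : ℤ, 0 ≤ n * κ → a (b ((a ^ n) (c (s₀ + |L|)))) = (a ^ n) (c (s₀ + |L|)) :=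
    fun n hn => by rw [hc.zpow_apply, hb _ (by linarith)]
  rcases hκ.lt_or_gt with h0 | h0
  · refine Set.infinite_of_injective_forall_mem (f := fun n : ℕ => -(n : ℤ))
      (fun m n h => by simpa using h) fun n => hmem _ ?_
    push_cast
    nlinarith [n.cast_nonneg (α := ℝ)]
  · refine Set.infinite_of_injective_forall_mem (f := fun n : ℕ => (n : ℤ))
      (fun m n h => by simpa using h) fun n => hmem _ ?_
    push_cast
    positivity

theorem IsTransLine.reflect {X : Type*} [MetricSpace X] {g : X ≃ᵢ X} {ℓ : ℝ} {c : ℝ → X}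
    (hc : IsTransLine g ℓ c) : IsTransLine g (-ℓ) fun t => c (-t) :=
  ⟨fun s t => by rw [hc.1, neg_sub_neg, abs_sub_comm], fun t => by
    change g (c (-t)) = c (-(t + -ℓ))
    rw [hc.2]; congr 1; ring⟩

theorem isClosed_minSet {X : Type*} [MetricSpace X] (g : X ≃ᵢ X) : IsClosed (MinSet ⇑g) :=
  isClosed_eq (continuous_id.dist g.continuous) continuous_const

/-- Two fixed-point-free isometries of an `ℝ`-tree whose product is elliptic, but shares few
fixed points with its conjugates, have axes meeting in a nondegenerate segment. -/
theorem IsRTree.exists_segment {T : Type*} [MetricSpace T] (hT : IsRTree T) {a b : T ≃ᵢ T}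
    (ha : ∀ x, a x ≠ x) (hb : ∀ x, b x ≠ x) {p : T} (hp : a (b p) = p)
    (hfin : ∀ x, {n : ℤ | a (b ((a ^ n) x)) = (a ^ n) x}.Finite) :
    ∃ w, 0 < w ∧ ∃ c : ℝ → T, (∀ s t, dist (c s) (c t) = |s - t|) ∧
      c '' Set.Icc 0 w = MinSet ⇑a ∩ MinSet ⇑b := by
  have hLa := hT.transLen_pos ha p
  have hLb := hT.transLen_pos hb p
  have hD : dist (b p) (a (b p)) = dist p (b p) := by rw [hp, dist_comm]
  have hDa : transLen ⇑a ≤ dist p (b p) := hD ▸ transLen_le a (b p)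
  have hDb : transLen ⇑b ≤ dist p (b p) := transLen_le b p
  have hcentral : ∀ l ∈ Set.Icc (0 : ℝ) 1, |1 - 2 * l| * dist p (b p) ≤ transLen ⇑a →
      |1 - 2 * l| * dist p (b p) ≤ transLen ⇑b →
      geoPt hT.1 p (b p) l ∈ MinSet ⇑a ∩ MinSet ⇑b := by
    intro l hl h1 h2
    have g1 := dist_left_geoPt hT.1 p (b p) hl
    have g2 := dist_geoPt_right hT.1 p (b p) hl
    have e1 := mul_le_mul_of_nonneg_right (le_abs_self (1 - 2 * l)) (dist_nonneg (x := p) (y := b p))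
    have e2 := mul_le_mul_of_nonneg_right (neg_abs_le (1 - 2 * l)) (dist_nonneg (x := p) (y := b p))
    refine ⟨hT.mem_minSet ha (x := b p) ?_ ?_ ?_, hT.mem_minSet hb (x := p) ?_ ?_ ?_⟩
    · rw [hp, dist_comm (b p), dist_comm _ p, g1, g2, dist_comm (b p)]; ring
    · rw [hp, dist_comm _ p, dist_comm _ p, g1]; linarith
    · rw [hp, dist_comm _ p, dist_comm _ p, g1]; linarith
    · rw [g1, g2]; ring
    · rw [g2]; linarith
    · rw [g2]; linarith
  have hDpos : 0 < dist p (b p) := hLa.trans_le hDa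
  set e := min (transLen ⇑a) (transLen ⇑b) / dist p (b p) with he
  have hepos : 0 < e := div_pos (lt_min hLa hLb) hDpos
  have he1 : e ≤ 1 := (div_le_one hDpos).2 ((min_le_left _ _).trans hDa)
  have heD : e * dist p (b p) = min (transLen ⇑a) (transLen ⇑b) := div_mul_cancel₀ _ hDpos.ne'
  have hm₁ := hcentral (1 / 2) (by norm_num) (by norm_num; exact hLa.le) (by norm_num; exact hLb.le)
  have hl₂ : (1 - e) / 2 ∈ Set.Icc (0 : ℝ) 1 := ⟨by linarith, by linarith⟩
  have habs : |1 - 2 * ((1 - e) / 2)| = e := by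
    rw [mul_div_cancel₀ _ two_ne_zero, sub_sub_cancel, abs_of_pos hepos]
  have hm₂ := hcentral ((1 - e) / 2) hl₂ (by rw [habs, heD]; exact min_le_left _ _)
    (by rw [habs, heD]; exact min_le_right _ _)
  have hne : geoPt hT.1 p (b p) (1 / 2) ≠ geoPt hT.1 p (b p) ((1 - e) / 2) := by
    intro h
    have h1 := dist_left_geoPt hT.1 p (b p) (l := 1 / 2) (by norm_num)
    rw [h, dist_left_geoPt hT.1 p (b p) hl₂] at h1
    nlinarith
  obtain ⟨c, hc, hc0⟩ := hT.exists_isTransLine_of_mem_minSet ha hm₁.1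
  obtain ⟨c', hc', -⟩ := hT.exists_isTransLine_of_mem_minSet hb hm₁.2
  have hrange' : Set.range c' = MinSet ⇑b := by
    refine Set.Subset.antisymm ?_ fun x hx => hT.mem_range_of_mem_minSet hb hc' hx
    rintro _ ⟨t, rfl⟩
    change dist _ _ = _
    rw [hc'.2, hc'.1, sub_add_cancel_left, abs_neg, abs_of_pos hLb]
  have hrange : Set.range c = MinSet ⇑a := by
    refine Set.Subset.antisymm ?_ fun x hx => hT.mem_range_of_mem_minSet ha hc hx
    rintro _ ⟨t, rfl⟩
    change dist _ _ = _
    rw [hc.2, hc.1, sub_add_cancel_left, abs_neg, abs_of_pos hLa]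
  set S : Set ℝ := c ⁻¹' MinSet ⇑b with hS
  have hSconn : S.OrdConnected := by
    refine Set.ordConnected_of_Ioo fun s hs u hu hsu t ht => ?_
    have hs' : c s ∈ Set.range c' := hrange' ▸ hs
    have hu' : c u ∈ Set.range c' := hrange' ▸ hu
    obtain ⟨s', hs'⟩ := hs'
    obtain ⟨u', hu'⟩ := hu'
    have hsu' : |s' - u'| = u - s := by
      rw [← hc'.1, hs', hu', hc.1, abs_sub_comm, abs_of_pos (by linarith)]
    have : ∃ t', |s' - t'| = t - s ∧ |t' - u'| = u - t := by
      rcases (abs_eq (by linarith)).1 hsu' with h | h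
      · exact ⟨s' - (t - s), by rw [sub_sub_cancel, abs_of_pos (by linarith [ht.1])],
          by rw [abs_of_pos (by linarith [ht.2])]; linarith⟩
      · exact ⟨s' + (t - s), by rw [sub_add_cancel_left, abs_neg, abs_of_pos (by linarith [ht.1])],
          by rw [abs_of_neg (by linarith [ht.2])]; linarith⟩
    obtain ⟨t', h1, h2⟩ := this
    have h3 : |s - t| = t - s := by rw [abs_of_neg (by linarith [ht.1])]; ring
    have h4 : |t - u| = u - t := by rw [abs_of_neg (by linarith [ht.2])]; ring
    have h5 : |s - u| = u - s := by rw [abs_of_neg (by linarith)]; ring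
    have : c t = c' t' := hT.eq_of_between (x := c s) (y := c u)
      (by rw [hc.1, hc.1, hc.1, h3, h4, h5]; ring)
      (by rw [← hs', ← hu', hc'.1, hc'.1, hc'.1, h1, h2, hsu']; ring)
      (by rw [hc.1, ← hs', hc'.1, h1, h3])
    change c t ∈ MinSet ⇑b
    rw [this, ← hrange']
    exact ⟨t', rfl⟩
  have hSclosed : IsClosed S := (isClosed_minSet b).preimage hc.continuous
  obtain ⟨t₂, ht₂⟩ : geoPt hT.1 p (b p) ((1 - e) / 2) ∈ Set.range c := hrange ▸ hm₂.1
  have h0S : (0 : ℝ) ∈ S := by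
    change c 0 ∈ MinSet ⇑b
    rw [hc0]; exact hm₁.2
  have ht₂S : t₂ ∈ S := by
    change c t₂ ∈ MinSet ⇑b
    rw [ht₂]; exact hm₂.2
  have hbddA : BddAbove S := by
    by_contra hbdd
    obtain ⟨x, hx⟩ := exists_infinite_fixed_of_ray hp hLa.ne' hc hc' (s₀ := 0) fun t ht => by
      obtain ⟨u, hu, htu⟩ := not_bddAbove_iff.1 hbdd t
      rw [hrange']
      exact hSconn.out h0S hu ⟨ht, htu.le⟩
    exact hx (hfin x)
  have hbddB : BddBelow S := by
    by_contra hbdd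
    obtain ⟨x, hx⟩ := exists_infinite_fixed_of_ray hp (neg_ne_zero.2 hLa.ne') hc.reflect hc'
      (s₀ := 0) fun t ht => by
        obtain ⟨u, hu, htu⟩ := not_bddBelow_iff.1 hbdd (-t)
        rw [hrange']
        exact hSconn.out hu h0S ⟨htu.le, by linarith⟩
    exact hx (hfin x)
  have hcomp : IsCompact S := Metric.isCompact_of_isClosed_isBounded hSclosed
    (isBounded_iff_bddBelow_bddAbove.2 ⟨hbddB, hbddA⟩)
  obtain ⟨s₀, s₁, hIcc⟩ : ∃ s₀ s₁, S = Set.Icc s₀ s₁ :=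
    ⟨_, _, eq_Icc_of_connected_compact ⟨⟨0, h0S⟩, hSconn.isPreconnected⟩ hcomp⟩
  have ht₂0 : t₂ ≠ 0 := by
    rintro rfl
    exact hne (hc0.symm.trans ht₂)
  have hw : 0 < s₁ - s₀ := by
    have h1 := h0S
    have h2 := ht₂S
    rw [hIcc] at h1 h2
    rcases ht₂0.lt_or_gt with h | h
    · linarith [h1.2, h2.1]
    · linarith [h1.1, h2.2]
  refine ⟨_, hw, fun t => c (s₀ + t), (hc.shift _).1, ?_⟩
  ext x
  constructor
  · rintro ⟨t, ht, rfl⟩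
    have : s₀ + t ∈ S := by
      rw [hIcc]; exact ⟨by linarith [ht.1], by linarith [ht.2]⟩
    exact ⟨hrange ▸ ⟨_, rfl⟩, this⟩
  · rintro ⟨h1, h2⟩
    rw [← hrange] at h1
    obtain ⟨t, rfl⟩ := h1
    have : t ∈ S := h2
    rw [hIcc] at this
    exact ⟨t - s₀, ⟨by linarith [this.1], by linarith [this.2]⟩, by simp⟩

/-! ### Algebra of the dihedral-type Artin groups -/

theorem map_altProd {G H : Type*} [Monoid G] [Monoid H] (f : G →* H) (x y : G) (k : ℕ) :
    f (altProd x y k) = altProd (f x) (f y) k := by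
  induction k generalizing x y with
  | zero => exact map_one f
  | succ k ih => simp only [altProd, map_mul, ih]

theorem altProd_two_mul {G : Type*} [Monoid G] (x y : G) (i : ℕ) :
    altProd x y (2 * i) = (x * y) ^ i := by
  induction i with
  | zero => rw [pow_zero]; rfl
  | succ i ih => rw [pow_succ', ← ih, mul_assoc]; rfl

theorem semiconjBy_mul_swap_pow {G : Type*} [Monoid G] (x y : G) (i : ℕ) :
    x * (y * x) ^ i = (x * y) ^ i * x :=
  SemiconjBy.pow_right (show x * (y * x) = x * y * x from (mul_assoc _ _ _).symm) i

theorem altProd_two_mul_add_one {G : Type*} [Monoid G] (x y : G) (i : ℕ) :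
    altProd x y (2 * i + 1) = (x * y) ^ i * x := by
  rw [← semiconjBy_mul_swap_pow, ← altProd_two_mul]; rfl

theorem altProd_relation {m : ℕ} :
    altProd (PresentedGroup.of 0 : PresentedGroup (dihedralRel m)) (PresentedGroup.of 1) m =
      altProd (PresentedGroup.of 1) (PresentedGroup.of 0) m := by
  have h := PresentedGroup.one_of_mem (rels := dihedralRel m) rfl
  rw [map_mul, map_inv, mul_inv_eq_one, map_altProd, map_altProd] at h
  exact h

theorem exists_dihedral_hom {G : Type*} [Group G] {m : ℕ} {x y : G}
    (h : altProd x y m = altProd y x m) :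
    ∃ f : PresentedGroup (dihedralRel m) →* G,
      f (PresentedGroup.of 0) = x ∧ f (PresentedGroup.of 1) = y := by
  refine ⟨PresentedGroup.toGroup (f := ![x, y]) ?_, ?_, ?_⟩
  · rintro r rfl
    rw [map_mul, map_inv, mul_inv_eq_one, map_altProd, map_altProd]
    simpa using h
  · rw [PresentedGroup.toGroup.of]; rfl
  · rw [PresentedGroup.toGroup.of]; rfl

/-- The element `(a,b)_m` or its square is a central power of `ab`. -/
theorem exists_central_power {G : Type*} [Group G] {m : ℕ} (hm : m ≠ 0) {a b : G}
    (h : altProd a b m = altProd b a m) :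
    ∃ N : ℕ, 0 < N ∧ (if m % 2 = 1 then altProd a b m ^ 2 else altProd a b m) = (a * b) ^ N ∧
      Commute ((a * b) ^ N) a ∧ Commute ((a * b) ^ N) b := by
  obtain ⟨i, rfl | rfl⟩ := m.even_or_odd'
  · rw [altProd_two_mul, altProd_two_mul] at h
    refine ⟨i, by omega, ?_, ?_, ?_⟩
    · rw [if_neg (by omega), altProd_two_mul]
    · rw [Commute, SemiconjBy, ← semiconjBy_mul_swap_pow, h]
    · rw [Commute, SemiconjBy, semiconjBy_mul_swap_pow, h]
  · have e : altProd a b (2 * i + 1) ^ 2 = (a * b) ^ (2 * i + 1) := by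
      nth_rewrite 1 [pow_two]
      nth_rewrite 2 [h]
      rw [altProd_two_mul_add_one, altProd_two_mul_add_one, mul_assoc, ← mul_assoc a,
        semiconjBy_mul_swap_pow, mul_assoc _ a b, ← pow_succ, ← pow_add]
      congr 1; ring
    have h1 : a * altProd a b (2 * i + 1) = altProd a b (2 * i + 1) * b := by
      nth_rewrite 1 [h]
      rw [altProd_two_mul_add_one, altProd_two_mul_add_one, ← mul_assoc, semiconjBy_mul_swap_pow]
    have h2 : b * altProd a b (2 * i + 1) = altProd a b (2 * i + 1) * a := by
      nth_rewrite 2 [h]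
      rw [altProd_two_mul_add_one, altProd_two_mul_add_one, ← mul_assoc, semiconjBy_mul_swap_pow]
    refine ⟨2 * i + 1, by omega, by rw [if_pos (by omega), e], ?_, ?_⟩
    · rw [← e, Commute, SemiconjBy, pow_two, ← mul_assoc, h1, mul_assoc, mul_assoc, h2]
    · rw [← e, Commute, SemiconjBy, pow_two, ← mul_assoc, h2, mul_assoc, mul_assoc, h1]

theorem altProd_eq_of_swap {G : Type*} [Group G] {a b w : G} {m : ℕ} (h₁ : b * w = w * a)
    (h₂ : a * w = w * b) (h : Commute w ((a * w) ^ m)) : altProd a b m = altProd b a m := by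
  have key : ∀ k, altProd a b k * w ^ k = (a * w) ^ k ∧ altProd b a k * w ^ k = (b * w) ^ k := by
    intro k
    induction k with
    | zero => simp [altProd]
    | succ k ih =>
      constructor
      · rw [altProd, pow_succ, mul_assoc, ← mul_assoc _ (w ^ k), ih.2, h₁,
          ← semiconjBy_mul_swap_pow, ← mul_assoc, ← pow_succ']
      · rw [altProd, pow_succ, mul_assoc, ← mul_assoc _ (w ^ k), ih.1, h₂,
          ← semiconjBy_mul_swap_pow, ← mul_assoc, ← pow_succ']
  have e : (b * w) ^ m = (a * w) ^ m := by
    rw [h₁, ← mul_left_inj w, ← semiconjBy_mul_swap_pow, h.eq]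
  rw [← mul_left_inj (w ^ m), (key m).1, (key m).2, e]

open Matrix in
/-- For `m ≥ 3` no nontrivial power of one generator of `A(m)` commutes with the other. -/
theorem not_commute_pow {m : ℕ} (hm : 3 ≤ m) {n : ℕ} (hn : n ≠ 0) :
    ¬ Commute ((PresentedGroup.of 0 : PresentedGroup (dihedralRel m)) ^ n) (PresentedGroup.of 1) ∧
    ¬ Commute ((PresentedGroup.of 1 : PresentedGroup (dihedralRel m)) ^ n)
      (PresentedGroup.of 0) := by
  set θ : ℝ := Real.pi / m with hθ
  have hm0 : (3 : ℝ) ≤ m := by exact_mod_cast hm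
  have hθ0 : 0 < θ := div_pos Real.pi_pos (by linarith)
  have hθ1 : θ < Real.pi / 2 := div_lt_div_of_pos_left Real.pi_pos two_pos (by linarith)
  have hsin : 0 < Real.sin θ := Real.sin_pos_of_pos_of_lt_pi hθ0 (by linarith [Real.pi_pos])
  have hcos : 0 < Real.cos θ := Real.cos_pos_of_mem_Ioo ⟨by linarith, hθ1⟩
  set c := 2 * Real.cos θ with hc
  obtain ⟨A, hA⟩ : ∃ A : (Matrix (Fin 2) (Fin 2) ℝ)ˣ, A.1 = !![1, c; 0, 1] :=
    ⟨⟨_, !![1, -c; 0, 1], by simp [one_fin_two], by simp [one_fin_two]⟩, rfl⟩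
  obtain ⟨B, hB⟩ : ∃ B : (Matrix (Fin 2) (Fin 2) ℝ)ˣ, B.1 = !![1, 0; -c, 1] :=
    ⟨⟨_, !![1, 0; c, 1], by simp [one_fin_two], by simp [one_fin_two]⟩, rfl⟩
  obtain ⟨W, hW⟩ : ∃ W : (Matrix (Fin 2) (Fin 2) ℝ)ˣ, W.1 = !![0, 1; -1, 0] :=
    ⟨⟨_, !![0, -1; 1, 0], by simp [one_fin_two], by simp [one_fin_two]⟩, rfl⟩
  have hAW : A.1 * W.1 = !![-c, 1; -1, 0] := by simp [hA, hW]
  have hpow : ∀ k : ℕ, Real.sin θ • (A.1 * W.1) ^ (k + 1) =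
      (-1 : ℝ) ^ k • (Real.sin ((k + 1) * θ) • !![-c, 1; -1, 0] + Real.sin (k * θ) • 1) := by
    intro k
    induction k with
    | zero => simp [hAW]
    | succ k ih =>
      have e : Real.sin ((k + 1 + 1) * θ) = c * Real.sin ((k + 1) * θ) - Real.sin (k * θ) := by
        have h1 : (k + 1 + 1) * θ = (k + 1) * θ + θ := by ring
        have h2 : k * θ = (k + 1) * θ - θ := by ring
        rw [h1, h2, Real.sin_add, Real.sin_sub, hc]; ring
      rw [pow_succ, ← smul_mul_assoc, ih, hAW]
      push_cast
      rw [e, pow_succ]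
      ext i j
      fin_cases i <;> fin_cases j <;> simp [Matrix.mul_apply, Fin.sum_univ_two] <;> ring
  have hcomm : Commute W ((A * W) ^ m) := by
    obtain ⟨k, rfl⟩ := Nat.exists_eq_add_of_le' (show 1 ≤ m by omega)
    have h1 := hpow k
    have h2 : ((k : ℝ) + 1) * θ = Real.pi := by
      rw [hθ]; push_cast; field_simp
    rw [h2, Real.sin_pi, zero_smul, zero_add] at h1
    refine Units.ext (smul_right_injective _ hsin.ne' ?_)
    simp only [Units.val_mul, Units.val_pow_eq_pow_val]
    rw [← mul_smul_comm, ← smul_mul_assoc, h1]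
    simp
  obtain ⟨f, hf0, hf1⟩ := exists_dihedral_hom (m := m) (x := A) (y := B)
    (altProd_eq_of_swap (w := W) (Units.ext (by simp [hA, hB, hW]))
      (Units.ext (by simp [hA, hB, hW])) hcomm)
  have hAn : ∀ k : ℕ, A.1 ^ k = !![1, k * c; 0, 1] := by
    intro k
    induction k with
    | zero => simp [one_fin_two]
    | succ k ih =>
      rw [pow_succ, ih, hA]
      simp
      ring
  have hBn : ∀ k : ℕ, B.1 ^ k = !![1, 0; -(k * c), 1] := by
    intro k
    induction k with
    | zero => simp [one_fin_two]
    | succ k ih =>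
      rw [pow_succ, ih, hB]
      simp
      ring
  have hnc : (n : ℝ) * c * c ≠ 0 := by positivity
  constructor <;> intro h
  · have h1 := congrArg (fun g => g.1 0 0) (h.map f).eq
    simp only [map_pow, hf0, hf1, Units.val_mul, Units.val_pow_eq_pow_val, hAn, hB] at h1
    simp at h1
    simp_all
  · have h1 := congrArg (fun g => g.1 0 0) (h.map f).eq
    simp only [map_pow, hf0, hf1, Units.val_mul, Units.val_pow_eq_pow_val, hBn, hA] at h1
    simp at h1
    simp_all

theorem mul_pow_ne_one {m : ℕ} {n : ℕ} (hn : n ≠ 0) :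
    ((PresentedGroup.of 0 : PresentedGroup (dihedralRel m)) * PresentedGroup.of 1) ^ n ≠ 1 := by
  intro h
  obtain ⟨f, h0, h1⟩ := exists_dihedral_hom (m := m) (x := Multiplicative.ofAdd (1 : ℤ)) rfl
  have := congrArg f h
  rw [map_pow, map_mul, h0, h1, map_one f] at this
  have h2 : n • (1 + 1 : ℤ) = 0 := congrArg Multiplicative.toAdd this
  simp [hn] at h2

/-! ### Assembling the strip -/

/-- In the coordinates `F` of a product `T × ℝ`, the isometry `f` acts as the product of `ψ`
and the translation by `α`. -/
def ActsAs {X T : Type*} [MetricSpace X] [MetricSpace T] (F : T → ℝ → X) (f : X ≃ᵢ X)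
    (ψ : T ≃ᵢ T) (α : ℝ) : Prop :=
  ∀ p t, f (F p t) = F (ψ p) (t + α)

namespace ActsAs

variable {X T : Type*} [MetricSpace X] [MetricSpace T] {F : T → ℝ → X} {f f' : X ≃ᵢ X}
  {ψ ψ' : T ≃ᵢ T} {α α' : ℝ}

theorem mul (h : ActsAs F f ψ α) (h' : ActsAs F f' ψ' α') :
    ActsAs F (f * f') (ψ * ψ') (α' + α) := fun p t => by
  rw [IsometryEquiv.mul_apply, IsometryEquiv.mul_apply, h', h, add_assoc]

theorem inv (h : ActsAs F f ψ α) : ActsAs F f⁻¹ ψ⁻¹ (-α) := fun p t => by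
  have h1 := h (ψ⁻¹ p) (t + -α)
  have h2 : ψ (ψ⁻¹ p) = p := ψ.apply_inv_self p
  rw [h2, neg_add_cancel_right] at h1
  rw [← h1]
  exact f.inv_apply_self _

theorem pow (h : ActsAs F f ψ α) (n : ℕ) : ActsAs F (f ^ n) (ψ ^ n) (n * α) := by
  induction n with
  | zero => intro p t; simp
  | succ n ih =>
    rw [pow_succ, pow_succ]
    convert ih.mul h using 1
    push_cast; ring

theorem exists_zpow (h : ActsAs F f ψ α) (n : ℤ) : ∃ β, ActsAs F (f ^ n) (ψ ^ n) β := by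
  obtain ⟨m, rfl | rfl⟩ := n.eq_nat_or_neg
  · exact ⟨m * α, by simpa using h.pow m⟩
  · exact ⟨_, by simpa using (h.pow m).inv⟩

variable (hT : IsRTree T)
  (hF : ∀ p q s t, dist (F p s) (F q t) ^ 2 = dist p q ^ 2 + (s - t) ^ 2)

include hT hF

/-- A product isometry with hyperbolic tree component realizes its translation length
exactly over the axis of the tree component. -/
theorem mem_minSet_iff (h : ActsAs F f ψ α) (hψ : ∀ x, ψ x ≠ x) {q : T} (hq : q ∈ MinSet ⇑ψ)
    (p : T) (t : ℝ) : F p t ∈ MinSet ⇑f ↔ p ∈ MinSet ⇑ψ := by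
  have hsq : ∀ p t, dist (F p t) (f (F p t)) ^ 2 = dist p (ψ p) ^ 2 + α ^ 2 := fun p t => by
    rw [h, hF]; ring
  have hmin : ∀ p ∈ MinSet ⇑ψ, ∀ t, F p t ∈ MinSet ⇑f := by
    intro p hp t
    obtain ⟨c, hc, rfl⟩ := hT.exists_isTransLine_of_mem_minSet hψ hp
    refine (transLen_eq (dist_le_of_dist_pow f (F (c 0) t) fun n => ?_)).symm
    refine (pow_left_inj₀ dist_nonneg (mul_nonneg n.cast_nonneg dist_nonneg) two_ne_zero).1 ?_
    rw [mul_pow, hsq, h.pow, hF, hc.pow_apply, hc.2, hc.1, hc.1, sq_abs, sq_abs]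
    ring
  refine ⟨fun hp => ?_, fun hp => hmin p hp t⟩
  have h1 := hsq p t
  have h2 := hsq q t
  rw [show dist _ _ = _ from hp] at h1
  rw [show dist _ _ = _ from hmin q hq t, h1, show dist q _ = _ from hq] at h2
  have h3 : 0 ≤ transLen ⇑ψ := hq ▸ dist_nonneg
  exact (pow_left_inj₀ dist_nonneg h3 two_ne_zero).1 (by linarith)

end ActsAs

theorem ProperlyDisc.transLen_pos {G X : Type*} [Group G] [MetricSpace X] {φ : G →* (X ≃ᵢ X)}
    (hpd : ProperlyDisc φ) {g : G} (hss : SemiSimple ⇑(φ g)) (hg : ∀ n : ℕ, n ≠ 0 → g ^ n ≠ 1) :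
    0 < transLen ⇑(φ g) := by
  obtain ⟨x, hx⟩ := hss
  refine (hx ▸ dist_nonneg : 0 ≤ transLen ⇑(φ g)).lt_of_ne fun h0 => ?_
  have hfix : φ g x = x := by
    rw [← h0, dist_eq_zero] at hx
    exact hx.symm
  have hinj : Function.Injective fun n : ℕ => g ^ n :=
    injective_pow_iff_not_isOfFinOrder.2 fun h => by
      obtain ⟨n, hn, h1⟩ := isOfFinOrder_iff_pow_eq_one.1 h
      exact hg n hn.ne' h1
  refine Set.infinite_of_injective_forall_mem hinj (fun n => ?_) (hpd {x} isCompact_singleton)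
  refine ⟨x, ⟨x, rfl, ?_⟩, rfl⟩
  rw [map_pow]
  have := dist_pow_le (φ g) x n
  rw [hfix, dist_self, mul_zero] at this
  exact (dist_le_zero.1 this).symm

/-- Infinitely many elements preserving a line translated by `z` agree up to powers of `z`. -/
theorem ProperlyDisc.exists_eq_zpow_mul {G X ι : Type*} [Group G] [MetricSpace X]
    {φ : G →* (X ≃ᵢ X)} (hpd : ProperlyDisc φ) [Infinite ι] {z : G} {ℓ : ℝ} (hℓ : 0 < ℓ)
    {c : ℝ → X} (hc : IsTransLine (φ z) ℓ c) (g : ι → G)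
    (hg : ∀ i, ∃ α, φ (g i) (c 0) = c α) :
    ∃ i j, i ≠ j ∧ ∃ k : ℤ, g i = z ^ k * g j := by
  choose α hα using hg
  have hfin := hpd (c '' Set.Icc 0 ℓ) (isCompact_Icc.image hc.continuous)
  let h : ι → G := fun i => z ^ (-⌊α i / ℓ⌋) * g i
  have hmem : ∀ i, h i ∈ {g : G | (φ g '' (c '' Set.Icc 0 ℓ) ∩ c '' Set.Icc 0 ℓ).Nonempty} := by
    intro i
    refine ⟨c (α i + (-⌊α i / ℓ⌋ : ℤ) * ℓ), ⟨c 0, ⟨0, ⟨le_rfl, hℓ.le⟩, rfl⟩, ?_⟩, _, ?_, rfl⟩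
    · rw [map_mul, map_zpow, IsometryEquiv.mul_apply, hα, hc.zpow_apply]
    · have h1 := Int.floor_le (α i / ℓ)
      have h2 := (Int.lt_floor_add_one (α i / ℓ)).le
      rw [le_div_iff₀ hℓ] at h1
      rw [div_le_iff₀ hℓ] at h2
      push_cast
      constructor <;> linarith
  have : Finite {g : G | (φ g '' (c '' Set.Icc 0 ℓ) ∩ c '' Set.Icc 0 ℓ).Nonempty} := hfin
  obtain ⟨i, j, hij, he⟩ := Finite.exists_ne_map_eq_of_infinite fun i => (⟨h i, hmem i⟩ :
    {g : G | (φ g '' (c '' Set.Icc 0 ℓ) ∩ c '' Set.Icc 0 ℓ).Nonempty})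
  have he' : z ^ (-⌊α i / ℓ⌋) * g i = z ^ (-⌊α j / ℓ⌋) * g j := congrArg Subtype.val he
  refine ⟨i, j, hij, ⌊α i / ℓ⌋ + -⌊α j / ℓ⌋, ?_⟩
  rw [zpow_add, mul_assoc, ← he', ← mul_assoc, ← zpow_add, add_neg_cancel, zpow_zero, one_mul]

theorem commute_pow_natAbs {G : Type*} [Group G] {g h : G} {n : ℤ} (hc : Commute (g ^ n) h) :
    Commute (g ^ n.natAbs) h := by
  rcases Int.natAbs_eq n with hn | hn <;> rw [hn] at hc
  · rwa [zpow_natCast] at hc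
  · rwa [zpow_neg, Commute.inv_left_iff, zpow_natCast] at hc

theorem ActsAs.ne_self {G X T : Type*} [Group G] [MetricSpace X] [MetricSpace T]
    {φ : G →* (X ≃ᵢ X)} (hpd : ProperlyDisc φ) {z : G} {ℓ : ℝ} (hℓ : 0 < ℓ) {F : T → ℝ → X}
    (hFz : ∀ p, IsTransLine (φ z) ℓ (F p)) {g h : G} {ψ : T ≃ᵢ T} {α : ℝ}
    (hg : ActsAs F (φ g) ψ α) (hzh : Commute z h) (hgh : ∀ n : ℕ, n ≠ 0 → ¬ Commute (g ^ n) h)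
    (x : T) : ψ x ≠ x := by
  intro hx
  have hxn : ∀ n : ℕ, (ψ ^ n) x = x := fun n => by
    have := dist_pow_le ψ x n
    rw [hx, dist_self, mul_zero] at this
    exact (dist_le_zero.1 this).symm
  obtain ⟨i, j, hij, k, hk⟩ := hpd.exists_eq_zpow_mul hℓ (hFz x) (fun n : ℕ => g ^ n) fun n =>
    ⟨_, by rw [map_pow, hg.pow n, hxn]⟩
  have h1 : g ^ ((i : ℤ) - j) = z ^ k := by
    rw [zpow_sub, zpow_natCast, zpow_natCast, hk, mul_inv_cancel_right]
  exact hgh _ (by omega) (commute_pow_natAbs (h1 ▸ hzh.zpow_left k))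

/-- The band theorem for a group generated like `A(m)` by `a` and `b`, with `(a * b) ^ N`
in the role of the central element. -/
theorem strip_of_central_power {G X : Type*} [Group G] [MetricSpace X] (hX : IsCAT0 X)
    (hdim : CovDimLE X 2) {φ : G →* (X ≃ᵢ X)} (hpd : ProperlyDisc φ)
    (hss : ∀ g, SemiSimple ⇑(φ g)) {a b : G} {N : ℕ} (hN : 0 < N)
    (hza : Commute ((a * b) ^ N) a) (hzb : Commute ((a * b) ^ N) b)
    (ha : ∀ n : ℕ, n ≠ 0 → ¬ Commute (a ^ n) b) (hb : ∀ n : ℕ, n ≠ 0 → ¬ Commute (b ^ n) a)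
    (hab : ∀ n : ℕ, n ≠ 0 → (a * b) ^ n ≠ 1) :
    (MinSet ⇑(φ a) ∩ MinSet ⇑(φ ((a * b) ^ N)) ∩ MinSet ⇑(φ b)).Nonempty ∧
    StripWithAxes ⇑(φ ((a * b) ^ N))
      (MinSet ⇑(φ a) ∩ MinSet ⇑(φ ((a * b) ^ N)) ∩ MinSet ⇑(φ b)) := by
  have hzpow : ∀ n : ℕ, n ≠ 0 → ((a * b) ^ N) ^ n ≠ 1 := fun n hn => by
    rw [← pow_mul]; exact hab _ (mul_ne_zero hN.ne' hn)
  set z := (a * b) ^ N with hz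
  have hℓ := hpd.transLen_pos (hss z) hzpow
  obtain ⟨T, _, F, _, hgeo, hF, hFz, hline, hcent⟩ := exists_splitting hX hℓ (hss z)
  have hT := isRTree_of_splitting hX hdim hgeo hF
  have hinj : ∀ {p q s t}, F p s = F q t → p = q := fun {p q s t} h => by
    have h1 := hF p q s t
    rw [h, dist_self] at h1
    exact dist_eq_zero.1 (pow_eq_zero_iff two_ne_zero |>.1
      (by nlinarith [sq_nonneg (dist p q), sq_nonneg (s - t)]))
  obtain ⟨ψa, αa, hψa⟩ := hcent (φ a) (hza.symm.map φ)
  obtain ⟨ψb, αb, hψb⟩ := hcent (φ b) (hzb.symm.map φ)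
  have hAa : ActsAs F (φ a) ψa αa := hψa
  have hAb : ActsAs F (φ b) ψb αb := hψb
  have hfa := hAa.ne_self hpd hℓ hFz hzb ha
  have hfb := hAb.ne_self hpd hℓ hFz hza hb
  have hAab : ActsAs F (φ (a * b)) (ψa * ψb) (αb + αa) := by
    rw [map_mul]; exact hAa.mul hAb
  obtain ⟨q, hq⟩ : ∃ q, ψa (ψb q) = q := by
    obtain ⟨x, hx⟩ := hss (a * b)
    obtain ⟨c, hc, -⟩ := hX.exists_isTransLine_of_mem_minSet _ hx (hpd.transLen_pos (hss _) hab)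
    set L := transLen ⇑(φ (a * b))
    have hcz : ∀ t, φ z (c t) = c (t + N * L) := fun t => by
      rw [hz, map_pow, hc.pow_apply]
    have hL : 0 ≤ L := hx ▸ dist_nonneg
    have hNL : transLen ⇑(φ z) = N * L := by
      have h0 : dist (c 0) (φ z (c 0)) = N * L := by
        rw [hcz, hc.1, zero_add, zero_sub, abs_neg, abs_of_nonneg (by positivity)]
      rw [← h0]
      refine transLen_eq (dist_le_of_dist_pow (φ z) (c 0) fun n => ?_)
      rw [h0, hz, map_pow, ← pow_mul, hc.pow_apply, hc.1, zero_add, zero_sub, abs_neg,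
        abs_of_nonneg (by positivity)]
      push_cast; ring
    obtain ⟨q, r, hqr⟩ := hline c ⟨hc.1, fun t => by rw [hcz, hNL]⟩
    refine ⟨q, ?_⟩
    have h1 := hc.2 0
    rw [hqr, hqr, hAab] at h1
    exact hinj h1
  have hfin : ∀ x, {n : ℤ | ψa (ψb ((ψa ^ n) x)) = (ψa ^ n) x}.Finite := by
    intro x
    by_contra hinf
    have : Infinite {n : ℤ | ψa (ψb ((ψa ^ n) x)) = (ψa ^ n) x} := Set.Infinite.to_subtype hinf
    obtain ⟨⟨i, hi⟩, ⟨j, hj⟩, hij, k, hk⟩ := hpd.exists_eq_zpow_mul hℓ (hFz x)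
      (fun n : {n : ℤ | ψa (ψb ((ψa ^ n) x)) = (ψa ^ n) x} =>
        (a ^ (n : ℤ))⁻¹ * (a * b) * a ^ (n : ℤ)) fun n => by
          obtain ⟨β, hβ⟩ := hAa.exists_zpow (n : ℤ)
          refine ⟨0 + β + (αb + αa) + -β, ?_⟩
          rw [map_mul, map_mul, map_inv, map_zpow, IsometryEquiv.mul_apply,
            IsometryEquiv.mul_apply, hβ, hAab, hβ.inv, IsometryEquiv.mul_apply,
            show ψa (ψb _) = _ from n.2]
          congr 1
          exact (ψa ^ (n : ℤ)).inv_apply_self x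
    have hconj : ∀ n : ℤ, ((a ^ n)⁻¹ * (a * b) * a ^ n) ^ N = z := fun n => by
      have h1 := conj_pow (i := N) (a := (a ^ n)⁻¹) (b := a * b)
      rw [inv_inv, ← hz] at h1
      rw [h1, ((hza.zpow_right n).inv_right).symm.eq, inv_mul_cancel_right]
    have hzj : Commute (z ^ k) ((a ^ j)⁻¹ * (a * b) * a ^ j) :=
      (((hza.zpow_right j).inv_right.mul_right (hza.mul_right hzb)).mul_right
        (hza.zpow_right j)).zpow_left k
    have hk0 : z ^ (k * N) = 1 := by
      have h1 := congrArg (· ^ N) hk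
      simp only [hzj.mul_pow, hconj] at h1
      rw [zpow_mul, zpow_natCast]
      exact mul_eq_right.1 h1.symm
    have hkN : k = 0 := by
      by_contra hk'
      have h1 : z ^ (k * N).natAbs = 1 := by
        rcases Int.natAbs_eq (k * N) with h | h <;> rw [h] at hk0
        · rwa [zpow_natCast] at hk0
        · rwa [zpow_neg, inv_eq_one, zpow_natCast] at hk0
      exact hzpow _ (by simp [hk', hN.ne']) h1
    rw [hkN, zpow_zero, one_mul] at hk
    have hcomm : Commute (a ^ (i - j)) (a * b) := by
      have h1 := congrArg (fun g => a ^ i * g * (a ^ j)⁻¹) hk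
      simp only [mul_assoc, mul_inv_cancel_left, mul_inv_cancel, mul_one] at h1
      rw [Commute, SemiconjBy, zpow_sub]
      simp only [mul_assoc]
      exact h1.symm
    have hcb : Commute (a ^ (i - j)) b := by
      have h1 := ((Commute.refl a).zpow_left (i - j)).inv_right.mul_right hcomm
      rwa [inv_mul_cancel_left] at h1
    have hne : i - j ≠ 0 := fun h => hij (Subtype.ext (sub_eq_zero.1 h))
    exact ha _ (by omega) (commute_pow_natAbs hcb)
  obtain ⟨w, hw, c, hc, hcS⟩ := hT.exists_segment hfa hfb hq hfin
  have h0 : c 0 ∈ MinSet ⇑ψa ∩ MinSet ⇑ψb := hcS ▸ ⟨0, ⟨le_rfl, hw.le⟩, rfl⟩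
  have hmem : ∀ p t, F p t ∈ MinSet ⇑(φ a) ∩ MinSet ⇑(φ z) ∩ MinSet ⇑(φ b) ↔
      p ∈ c '' Set.Icc 0 w := by
    intro p t
    have hz' : F p t ∈ MinSet ⇑(φ z) := by
      change dist _ _ = _
      rw [(hFz p).2, (hFz p).1, sub_add_cancel_left, abs_neg, abs_of_pos hℓ]
    rw [hcS, Set.mem_inter_iff, Set.mem_inter_iff, hAa.mem_minSet_iff hT hF hfa h0.1,
      hAb.mem_minSet_iff hT hF hfb h0.2, Set.mem_inter_iff]
    tauto
  refine ⟨⟨F (c 0) 0, (hmem _ _).2 ⟨0, ⟨le_rfl, hw.le⟩, rfl⟩⟩, w, hw,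
    fun x => F (c x.1) x.2, fun x y => ?_, ?_, fun s => ?_⟩
  · change dist (F (c x.1) x.2) (F (c y.1) y.2) = _
    rw [← Real.sqrt_sq (dist_nonneg (x := F (c x.1) x.2)), hF, hc, sq_abs]
  · ext x
    constructor
    · rintro ⟨⟨s, t⟩, rfl⟩
      exact (hmem _ _).2 ⟨s, s.2, rfl⟩
    · intro hx
      obtain ⟨l, hl, rfl⟩ := hX.exists_isTransLine_of_mem_minSet _ hx.1.2 hℓ
      obtain ⟨p, r, hpr⟩ := hline l hl
      rw [hpr] at hx ⊢
      obtain ⟨s, hs, rfl⟩ := (hmem _ _).1 hx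
      exact ⟨(⟨s, hs⟩, 0 + r), rfl⟩
  · exact ⟨fun t => F (c s) t, (hFz _).1, rfl, (hFz _).2⟩

/-- If the dihedral-type Artin group `A(m)`, `m ≥ 3`, acts properly
discontinuously by semi-simple isometries on a CAT(0) space of covering dimension ≤ 2,
then `B(a,b) = Min(a) ∩ Min(z) ∩ Min(b)` is a nonempty flat strip of positive width
foliated by axes of the central element `z`. -/
theorem dihedral_artin_band
    (m : ℕ) (hm : 3 ≤ m) (X : Type*) [MetricSpace X]
    (hX : IsCAT0 X) (hdim : CovDimLE X 2)
    (φ : PresentedGroup (dihedralRel m) →* (X ≃ᵢ X))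
    (hpd : ProperlyDisc φ) (hss : ∀ g, SemiSimple ⇑(φ g)) :
    let a : PresentedGroup (dihedralRel m) := PresentedGroup.of 0
    let b : PresentedGroup (dihedralRel m) := PresentedGroup.of 1
    let z : PresentedGroup (dihedralRel m) :=
      if m % 2 = 1 then (altProd a b m) ^ 2 else altProd a b m
    (MinSet ⇑(φ a) ∩ MinSet ⇑(φ z) ∩ MinSet ⇑(φ b)).Nonempty ∧
    StripWithAxes ⇑(φ z) (MinSet ⇑(φ a) ∩ MinSet ⇑(φ z) ∩ MinSet ⇑(φ b)) := by
  intro a b z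
  obtain ⟨N, hN, hz, hza, hzb⟩ := exists_central_power (by omega) (altProd_relation (m := m))
  have hz' : z = (a * b) ^ N := hz
  rw [hz']
  exact strip_of_central_power hX hdim hpd hss hN hza hzb
    (fun n hn => (not_commute_pow hm hn).1) (fun n hn => (not_commute_pow hm hn).2)
    (fun n hn => mul_pow_ne_one hn)
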